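/- Let g ≥ 2 be an integer, let F ∈ ℚ[x] be squarefree of degree 2g+1 or 2g+2, let K_F be the associated hyperelliptic function field over ℚ, let G be the group of ℚ-algebra automorphisms of K_F, and let w ∈ G be the hyperelliptic involution. If g is even, then G is isomorphic to a subgroup of the dihedral group of order 8 or to a subgroup of the dihedral group of order 12. If g is odd, then G is the internal direct product of the subgroup ⟨w⟩ of order 2 and a subgroup H isomorphic to a subgroup of the dihedral group of order 8 or of the dihedral group of order 12. In either case, every element of G has order 1, 2, 3, 4, or 6. -/

import Mathlib

open Polynomial

/-- Data exhibiting a field `K` (with a `k`-algebra structure) as the hyperelliptic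
function field `k(x)(y)` with `y² = F(x)`: elements `x, y ∈ K` with `x` transcendental
over `k`, `y² = F(x)`, and `K` generated as a field over `k` by `x` and `y`. -/
structure IsHyperellipticFunctionField (k : Type*) [Field k] (F : k[X])
    (K : Type*) [Field K] [Algebra k K] (x y : K) : Prop where
  transcendental_x : Transcendental k x
  sq : y ^ 2 = Polynomial.aeval x F
  adjoin_eq_top : IntermediateField.adjoin k ({x, y} : Set K) = ⊤

/-- The pair `(M, e)`, with `M = [[a,b],[c,d]] ∈ GL₂(k)` and `e ∈ kˣ`, represents the
`k`-algebra isomorphism `σ : K' → K` (where `K' = k(x')(y')` with `y'² = F'(x')` and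
`K = k(x)(y)` with `y² = F(x)`, both of genus `g`) if
`σ(x') = (a x + b)/(c x + d)` and `σ(y') = e y/(c x + d)^{g+1}`. -/
def Represents {k : Type*} [Field k] {K K' : Type*} [Field K] [Algebra k K]
    [Field K'] [Algebra k K'] (g : ℕ) (x y : K) (x' y' : K')
    (σ : K' ≃ₐ[k] K) (M : GL (Fin 2) k) (e : kˣ) : Prop :=
  σ x' = (algebraMap k K (M.val 0 0) * x + algebraMap k K (M.val 0 1)) /
      (algebraMap k K (M.val 1 0) * x + algebraMap k K (M.val 1 1)) ∧
  σ y' = algebraMap k K (e : k) * y /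
      (algebraMap k K (M.val 1 0) * x + algebraMap k K (M.val 1 1)) ^ (g + 1)

theorem exists_isCoprime_eq_mul {A : Type*} [CommRing A] [IsDomain A] [IsPrincipalIdealRing A]
    (a : A) {b : A} (hb : b ≠ 0) :
    ∃ d a' b' : A, d ≠ 0 ∧ IsCoprime a' b' ∧ a = d * a' ∧ b = d * b' := by
  let := UniqueFactorizationMonoid.toGCDMonoid A
  obtain ⟨a', b', ha, hb', hu⟩ := extract_gcd a b
  exact ⟨gcd a b, a', b', fun h0 ↦ hb (zero_dvd_iff.1 (h0 ▸ gcd_dvd_right a b)),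
    ((gcd_isUnit_iff_isRelPrime).1 hu).isCoprime, ha, hb'⟩

theorem Squarefree.dvd_of_sq_dvd_sq_mul {A : Type*} [CommRing A] [IsDomain A]
    [IsPrincipalIdealRing A] {F Q R : A} (hF : Squarefree F) (hR : R ≠ 0)
    (h : R ^ 2 ∣ Q ^ 2 * F) : R ∣ Q := by
  obtain ⟨d, Q', R', hd, hco, rfl, rfl⟩ := exists_isCoprime_eq_mul Q hR
  have h' : R' ^ 2 ∣ Q' ^ 2 * F := by
    refine (mul_dvd_mul_iff_left (pow_ne_zero 2 hd)).1 ?_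
    rwa [← mul_assoc, ← mul_pow, ← mul_pow]
  have hu' : IsUnit R' := hF R' (by simpa [sq] using hco.symm.pow.dvd_of_dvd_mul_left h')
  exact mul_dvd_mul_left d hu'.dvd

theorem Polynomial.eq_zero_of_sq_eq_mul_sq {k : Type*} [Field k] {F P Q : k[X]}
    (hF : Squarefree F) (hd : 0 < F.natDegree) (h : P ^ 2 = F * Q ^ 2) : Q = 0 := by
  by_contra hQ
  have hdvd : Q ∣ P := squarefree_one.dvd_of_sq_dvd_sq_mul hQ ⟨F, by rw [h]; ring⟩
  obtain ⟨R, rfl⟩ := hdvd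
  have hR : R * R = F := by
    apply mul_right_cancel₀ (pow_ne_zero 2 hQ)
    linear_combination h
  have hu : IsUnit R := hF R (Dvd.intro 1 (by rw [hR, mul_one]))
  have : F.natDegree = 0 := by
    rw [← hR]; exact natDegree_eq_zero_of_isUnit (hu.mul hu)
  omega

section CoordinateRing

variable {k K : Type*} [Field k] [CharZero k] [Field K] [Algebra k K]

namespace IsHyperellipticFunctionField

variable {F : k[X]} {x y : K}

theorem exists_quotient (h : IsHyperellipticFunctionField k F K x y) (hF : Squarefree F)
    (hd : 0 < F.natDegree) (f : K) :
    ∃ P Q R : k[X], R ≠ 0 ∧ aeval x R * f = aeval x P + aeval x Q * y := by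
  have hinj : ∀ p : k[X], aeval x p = 0 → p = 0 := fun p hp ↦
    (transcendental_iff.1 h.transcendental_x) p hp
  have hf : f ∈ IntermediateField.adjoin k ({x, y} : Set K) := by
    rw [h.adjoin_eq_top]; trivial
  induction hf using IntermediateField.adjoin_induction with
  | mem z hz =>
    rcases hz with rfl | rfl
    · exact ⟨X, 0, 1, one_ne_zero, by simp⟩
    · exact ⟨0, 1, 1, one_ne_zero, by simp⟩
  | algebraMap c => exact ⟨C c, 0, 1, one_ne_zero, by simp⟩
  | add a b _ _ ha hb =>
    obtain ⟨P, Q, R, hR, e⟩ := ha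
    obtain ⟨P', Q', R', hR', e'⟩ := hb
    refine ⟨R' * P + R * P', R' * Q + R * Q', R * R', mul_ne_zero hR hR', ?_⟩
    simp only [map_add, map_mul]
    linear_combination aeval x R' * e + aeval x R * e'
  | mul a b _ _ ha hb =>
    obtain ⟨P, Q, R, hR, e⟩ := ha
    obtain ⟨P', Q', R', hR', e'⟩ := hb
    refine ⟨P * P' + F * Q * Q', P * Q' + P' * Q, R * R', mul_ne_zero hR hR', ?_⟩
    simp only [map_add, map_mul]
    linear_combination aeval x R' * b * e + (aeval x P + aeval x Q * y) * e' +
      aeval x Q * aeval x Q' * h.sq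
  | inv a _ ha =>
    obtain ⟨P, Q, R, hR, e⟩ := ha
    by_cases ha0 : a = 0
    · exact ⟨0, 0, 1, one_ne_zero, by simp [ha0]⟩
    have hN : P ^ 2 - F * Q ^ 2 ≠ 0 := by
      intro h0
      have hQ : Q = 0 := eq_zero_of_sq_eq_mul_sq hF hd (sub_eq_zero.1 h0)
      have hP : P = 0 := by simpa [hQ] using h0
      rw [hP, hQ] at e
      simp only [map_zero, zero_mul, add_zero, mul_eq_zero, ha0, or_false] at e
      exact hR (hinj R e)
    refine ⟨R * P, -(R * Q), P ^ 2 - F * Q ^ 2, hN, ?_⟩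
    rw [← div_eq_mul_inv, div_eq_iff ha0]
    simp only [map_sub, map_mul, map_pow, map_neg]
    linear_combination (-aeval x P + aeval x Q * y) * e + aeval x Q ^ 2 * h.sq

end IsHyperellipticFunctionField

section FormallyEtale

theorem finiteDimensional_of_exists_quotient {k K : Type*} [Field k] [Field K]
    [Algebra k[X] K] [FaithfulSMul k[X] K] {y : K}
    (hgen : ∀ f : K, ∃ P Q R : k[X], R ≠ 0 ∧
      algebraMap k[X] K R * f = algebraMap k[X] K P + algebraMap k[X] K Q * y) :
    letI := FractionRing.liftAlgebra k[X] K
    FiniteDimensional (FractionRing k[X]) K := by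
  let := FractionRing.liftAlgebra k[X] K
  refine Module.Finite.of_fg_top (Submodule.fg_def.2 ⟨{1, y}, Set.toFinite _, ?_⟩)
  rw [eq_top_iff]
  rintro f -
  obtain ⟨P, Q, R, hR, e⟩ := hgen f
  have hR' : algebraMap k[X] K R ≠ 0 := by
    rwa [Ne, FaithfulSMul.algebraMap_eq_zero_iff]
  rw [Submodule.mem_span_pair]
  refine ⟨algebraMap k[X] _ P / algebraMap k[X] _ R, algebraMap k[X] _ Q / algebraMap k[X] _ R, ?_⟩
  rw [Algebra.smul_def, Algebra.smul_def, map_div₀, map_div₀,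
    ← IsScalarTower.algebraMap_apply, ← IsScalarTower.algebraMap_apply,
    ← IsScalarTower.algebraMap_apply]
  field_simp
  linear_combination -e

theorem exists_derivation_of_exists_quotient [Algebra k[X] K] [FaithfulSMul k[X] K]
    [IsScalarTower k k[X] K] {y : K}
    (hgen : ∀ f : K, ∃ P Q R : k[X], R ≠ 0 ∧
      algebraMap k[X] K R * f = algebraMap k[X] K P + algebraMap k[X] K Q * y) :
    ∃ D : Derivation k K K, D (algebraMap k[X] K X) = 1 := by
  let := FractionRing.liftAlgebra k[X] K
  have := finiteDimensional_of_exists_quotient hgen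
  have : Algebra.FormallyEtale k[X] (FractionRing k[X]) :=
    Algebra.FormallyEtale.of_isLocalization (nonZeroDivisors k[X])
  have : Algebra.FormallyEtale (FractionRing k[X]) K := Algebra.FormallyEtale.of_isSeparable _ _
  have : Algebra.FormallyEtale k[X] K := Algebra.FormallyEtale.comp k[X] (FractionRing k[X]) K
  let Φ : Ω[K⁄k] →ₗ[K] K :=
    (TensorProduct.AlgebraTensorModule.rid k[X] K K).toLinearMap ∘ₗ
    (TensorProduct.AlgebraTensorModule.map LinearMap.id
      (KaehlerDifferential.polynomialEquiv k).toLinearMap) ∘ₗ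
    (KaehlerDifferential.tensorKaehlerEquivOfFormallyEtale k k[X] K).symm.toLinearMap
  refine ⟨Φ.compDer (KaehlerDifferential.D k K), ?_⟩
  simp [Φ, KaehlerDifferential.tensorKaehlerEquivOfFormallyEtale_symm_D_algebraMap]

theorem mem_integralClosure_of_valuation_le_one {k K : Type*} [Field k] [CharZero k] [Field K]
    [Algebra k[X] K] [FaithfulSMul k[X] K] {y : K}
    (hgen : ∀ f : K, ∃ P Q R : k[X], R ≠ 0 ∧
      algebraMap k[X] K R * f = algebraMap k[X] K P + algebraMap k[X] K Q * y)
    {f : K}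
    (hf : ∀ O : ValuationSubring K, (∀ b ∈ integralClosure k[X] K, b ∈ O) →
      (∀ a ∈ O, ∃ n ∈ integralClosure k[X] K, ∃ d ∈ integralClosure k[X] K,
        d ≠ 0 ∧ d⁻¹ ∈ O ∧ a * d = n) → f ∈ O) :
    f ∈ integralClosure k[X] K := by
  let := FractionRing.liftAlgebra k[X] K
  have := finiteDimensional_of_exists_quotient hgen
  have : IsDedekindDomain (integralClosure k[X] K) :=
    integralClosure.isDedekindDomain k[X] (FractionRing k[X]) K
  have : IsFractionRing (integralClosure k[X] K) K :=
    integralClosure.isFractionRing_of_finite_extension (FractionRing k[X]) K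
  have key := IsDedekindDomain.HeightOneSpectrum.mem_integers_of_valuation_le_one
    (R := integralClosure k[X] K) K f fun v ↦ by
      refine hf (v.valuation K).valuationSubring (fun b hb ↦ v.valuation_le_one ⟨b, hb⟩)
        fun a ha ↦ ?_
      obtain ⟨n, d, e⟩ := v.exists_primeCompl_mul_eq_of_integer a ha
      have hd : v.valuation K (d.1 : K) = 1 := v.valuation_eq_one_iff_notMem.2 d.2
      refine ⟨n, n.2, d.1, d.1.2, ?_, ?_, e⟩
      · rintro h0
        rw [h0, map_zero] at hd
        exact zero_ne_one hd
      · change v.valuation K _ ≤ 1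
        rw [map_inv₀, hd, inv_one]
  obtain ⟨b, rfl⟩ := key
  exact b.2

end FormallyEtale

theorem Polynomial.dvd_of_isIntegral {k K : Type*} [Field k] [Field K] [Algebra k[X] K]
    [FaithfulSMul k[X] K] {P R : k[X]} {f : K}
    (hR : R ≠ 0) (hf : IsIntegral k[X] f)
    (e : algebraMap k[X] K R * f = algebraMap k[X] K P) : R ∣ P := by
  let := FractionRing.liftAlgebra k[X] K
  have hR' : algebraMap k[X] K R ≠ 0 := by
    rwa [Ne, FaithfulSMul.algebraMap_eq_zero_iff]
  have hf' : f = algebraMap (FractionRing k[X]) K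
      (algebraMap k[X] _ P / algebraMap k[X] _ R) := by
    rw [map_div₀, ← IsScalarTower.algebraMap_apply, ← IsScalarTower.algebraMap_apply,
      eq_div_iff hR', mul_comm, e]
  rw [hf', isIntegral_algebraMap_iff (algebraMap (FractionRing k[X]) K).injective] at hf
  obtain ⟨Q, hQ⟩ := IsIntegrallyClosed.isIntegral_iff.1 hf
  rw [hf', ← hQ, ← IsScalarTower.algebraMap_apply, ← map_mul] at e
  exact ⟨Q, (FaithfulSMul.algebraMap_injective k[X] K e).symm⟩

theorem exists_eq_add_mul_of_isIntegral {k K : Type*} [Field k] [CharZero k] [Field K]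
    [Algebra k[X] K] [FaithfulSMul k[X] K] {F : k[X]}
    (hF : Squarefree F) {y : K} (hy : y ^ 2 = algebraMap k[X] K F)
    (w : K →ₐ[k[X]] K) (hw : w y = -y)
    (hgen : ∀ f : K, ∃ P Q R : k[X], R ≠ 0 ∧
      algebraMap k[X] K R * f = algebraMap k[X] K P + algebraMap k[X] K Q * y)
    {f : K} (hf : IsIntegral k[X] f) :
    ∃ P Q : k[X], f = algebraMap k[X] K P + algebraMap k[X] K Q * y := by
  obtain ⟨P, Q, R, hR, e⟩ := hgen f
  have hR' : algebraMap k[X] K R ≠ 0 := by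
    rwa [Ne, FaithfulSMul.algebraMap_eq_zero_iff]
  have ew := congrArg w e
  simp only [map_mul, map_add, AlgHom.commutes, hw] at ew
  obtain ⟨P₁, hP₁⟩ : R ∣ P + P := by
    refine dvd_of_isIntegral hR (hf.add (hf.map w)) ?_
    rw [map_add]
    linear_combination e + ew
  obtain ⟨P₂, rfl⟩ : ∃ P₂, P = R * P₂ := by
    refine ⟨C (1 / 2) * P₁, ?_⟩
    have h2 : C (1 / 2 : k) * 2 = 1 := by
      rw [← C_ofNat, ← C_mul]
      simp
    linear_combination C (1 / 2) * hP₁ - P * h2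
  obtain ⟨Q₁, rfl⟩ : R ∣ Q := by
    refine hF.dvd_of_sq_dvd_sq_mul hR ?_
    refine dvd_of_isIntegral (f := (f - algebraMap k[X] K P₂) ^ 2) (pow_ne_zero 2 hR)
      ((hf.sub isIntegral_algebraMap).pow 2) ?_
    simp only [map_mul, map_pow, ← hy] at e ⊢
    have : algebraMap k[X] K R * (f - algebraMap k[X] K P₂) = algebraMap k[X] K Q * y := by
      linear_combination e
    rw [← mul_pow, this]
    ring
  refine ⟨P₂, Q₁, mul_left_cancel₀ hR' ?_⟩
  rw [e]
  simp only [map_mul]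
  ring

section Differential

variable {F₁ : k[X]} {s t : K} {O : ValuationSubring K}

theorem ValuationSubring.aeval_mem {k K : Type*} [Field k] [Field K] [Algebra k K]
    {O : ValuationSubring K} {t : K} (hk : ∀ c : k, algebraMap k K c ∈ O) (ht : t ∈ O) (p : k[X]) :
    aeval t p ∈ O := by
  induction p using Polynomial.induction_on' with
  | add p q hp hq => rw [map_add]; exact O.add_mem _ _ hp hq
  | monomial n a => rw [aeval_monomial]; exact O.mul_mem _ _ (hk a) (pow_mem ht n)

theorem ValuationSubring.mem_of_sq_mem (hs : s ^ 2 ∈ O) : s ∈ O := by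
  rcases eq_or_ne s 0 with rfl | h0
  · exact O.zero_mem
  rcases O.mem_or_inv_mem s with h | h
  · exact h
  · have := O.mul_mem _ _ hs h
    rwa [sq, mul_assoc, mul_inv_cancel₀ h0, mul_one] at this

theorem ValuationSubring.mul_derivation_div_mem (hF₁ : Squarefree F₁)
    (hk : ∀ c : k, algebraMap k K c ∈ O) {y : K} {D : Derivation k K K}
    (hD : ∀ a ∈ O, y * D a ∈ O) (ht : t ∈ O) (hs : s ^ 2 = aeval t F₁) (hs0 : s ≠ 0) :
    y * D t / s ∈ O := by
  have hsO : s ∈ O := mem_of_sq_mem (hs ▸ aeval_mem hk ht F₁)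
  obtain ⟨U, V, hUV⟩ : F₁.Separable := PerfectField.separable_iff_squarefree.2 hF₁
  have hUV' := congrArg (aeval t) hUV
  have hDs := congrArg D hs
  rw [D.map_aeval, D.leibniz_pow] at hDs
  simp only [map_add, map_mul, map_one, ← hs, smul_eq_mul, nsmul_eq_mul] at hUV' hDs
  have : y * D t / s = aeval t U * (s * (y * D t)) + aeval t V * (y * D s + y * D s) := by
    rw [div_eq_iff hs0]
    push_cast at hDs
    linear_combination -y * D t * hUV' - aeval t V * y * hDs
  rw [this]
  exact O.add_mem _ _ (O.mul_mem _ _ (aeval_mem hk ht U) (O.mul_mem _ _ hsO (hD t ht)))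
    (O.mul_mem _ _ (aeval_mem hk ht V) (O.add_mem _ _ (hD s hsO) (hD s hsO)))

theorem ValuationSubring.pow_mul_derivation_div_mem {g i : ℕ} (hi : i + 1 ≤ g) {F₂ : k[X]}
    (hF₁ : Squarefree F₁) (hF₂ : Squarefree F₂)
    (hk : ∀ c : k, algebraMap k K c ∈ O) {y : K} {D : Derivation k K K}
    (hD : ∀ a ∈ O, y * D a ∈ O) (hs : s ^ 2 = aeval t F₁) (hs0 : s ≠ 0) (ht0 : t ≠ 0)
    (hs' : (s / t ^ (g + 1)) ^ 2 = aeval t⁻¹ F₂) :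
    t ^ i * (y * D t / s) ∈ O := by
  rcases O.mem_or_inv_mem t with ht | ht
  · exact O.mul_mem _ _ (pow_mem ht i) (mul_derivation_div_mem hF₁ hk hD ht hs hs0)
  · have := mul_derivation_div_mem hF₂ hk hD ht hs' (div_ne_zero hs0 (pow_ne_zero _ ht0))
    obtain ⟨j, rfl⟩ := Nat.exists_eq_add_of_le hi
    have e : t ^ i * (y * D t / s) =
        -(t⁻¹ ^ j * (y * D t⁻¹ / (s / t ^ (i + 1 + j + 1)))) := by
      rw [D.leibniz_inv]
      simp only [smul_eq_mul, inv_pow]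
      field_simp
      ring
    rw [e]
    exact O.neg_mem _ (O.mul_mem _ _ (pow_mem ht j) this)

end Differential

end CoordinateRing

theorem Polynomial.aeval_reflect {k K : Type*} [Field k] [Field K] [Algebra k K] {F : k[X]}
    {x : K} {N : ℕ} (hN : F.natDegree ≤ N) (hx : x ≠ 0) :
    aeval x⁻¹ (reflect N F) = aeval x F / x ^ N := by
  let := invertibleOfNonzero hx
  have := eval₂_reflect_mul_pow (algebraMap k K) x N F hN
  rw [invOf_eq_inv] at this
  rw [eq_div_iff (pow_ne_zero _ hx)]
  exact this

theorem Polynomial.squarefree_reflect {k : Type*} [Field k] {F : k[X]} (hF : Squarefree F)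
    {g : ℕ} (hl : 2 * g + 1 ≤ F.natDegree) (hu : F.natDegree ≤ 2 * g + 2) :
    Squarefree (reflect (2 * g + 2) F) := by
  rintro p ⟨q, hq⟩
  have hF0 : F ≠ 0 := hF.ne_zero
  have hG0 : reflect (2 * g + 2) F ≠ 0 := by simpa using hF0
  have hp0 : p ≠ 0 := by rintro rfl; simp [hG0] at hq
  have hq0 : q ≠ 0 := by rintro rfl; simp [hG0] at hq
  have hdeg : (p * p * q).natDegree ≤ 2 * g + 2 := by
    rw [← hq]; exact natDegree_reflect_le.trans (max_le le_rfl hu)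
  rw [natDegree_mul (mul_ne_zero hp0 hp0) hq0, natDegree_mul hp0 hp0] at hdeg
  obtain ⟨m, hm⟩ := Nat.exists_eq_add_of_le
    (show p.natDegree + p.natDegree ≤ 2 * g + 2 by omega)
  have e : F = reflect p.natDegree p * reflect p.natDegree p * reflect m q := by
    rw [← reflect_mul p p le_rfl le_rfl,
      ← reflect_mul (p * p) q natDegree_mul_le (by omega), ← hm, ← hq, reflect_reflect]
  obtain ⟨c, hc, hpc⟩ := isUnit_iff.1 (hF _ ⟨_, e⟩)
  have hp : p = C c * X ^ p.natDegree := by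
    conv_lhs => rw [← reflect_reflect (N := p.natDegree) (p := p), ← hpc, reflect_C]
  have hdF : F.natDegree ≤ m := by
    rw [e, ← hpc]
    refine natDegree_mul_le.trans ?_
    rw [← C_mul, natDegree_C, zero_add]
    exact natDegree_reflect_le.trans (max_le le_rfl (by omega))
  rw [hp, show p.natDegree = 0 by omega, pow_zero, mul_one]
  exact isUnit_C.2 hc

theorem Polynomial.natDegree_reflect_pos {k : Type*} [Field k] {F : k[X]} (hF : Squarefree F)
    (g : ℕ) :
    0 < (reflect (2 * g + 2) F).natDegree := by
  by_contra h0
  obtain ⟨c, hc⟩ := natDegree_eq_zero.1 (Nat.eq_zero_of_not_pos h0)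
  have e : F = C c * X ^ (2 * g + 2) := by
    conv_lhs => rw [← reflect_reflect (N := 2 * g + 2) (p := F), ← hc, reflect_C]
  have : IsUnit (X : k[X]) := hF X ⟨C c * X ^ (2 * g), by rw [e]; ring⟩
  exact not_isUnit_X this

theorem Polynomial.aeval_mul_pow {k L : Type*} [Field k] [Field L] [Algebra k L] {F : k[X]}
    {n : ℕ} (hn : F.natDegree ≤ n) {u v z : L} (hz : z * v = u) :
    aeval z F * v ^ n = ∑ i ∈ Finset.range (n + 1), F.coeff i • (u ^ i * v ^ (n - i)) := by
  rw [aeval_eq_sum_range' (Nat.lt_succ_of_le hn), Finset.sum_mul]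
  refine Finset.sum_congr rfl fun i hi ↦ ?_
  rw [smul_mul_assoc, ← hz, mul_pow, mul_assoc, ← pow_add,
    Nat.add_sub_cancel' (Nat.lt_succ_iff.1 (Finset.mem_range.1 hi))]

section

variable {k K : Type*} [Field k] [Field K] [Algebra k K]

namespace IsHyperellipticFunctionField

variable {F : k[X]} {x y : K}

theorem linear_ne_zero (h : IsHyperellipticFunctionField k F K x y) {a b : k}
    (hab : ¬(a = 0 ∧ b = 0)) : algebraMap k K a * x + algebraMap k K b ≠ 0 := by
  intro h0
  have h1 : C a * X + C b = 0 := by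
    apply transcendental_iff_injective.1 h.transcendental_x
    simpa using h0
  exact hab ⟨by simpa using congrArg (coeff · 1) h1, by simpa using congrArg (coeff · 0) h1⟩

theorem denom_ne_zero (h : IsHyperellipticFunctionField k F K x y) (M : GL (Fin 2) k) :
    algebraMap k K (M.val 1 0) * x + algebraMap k K (M.val 1 1) ≠ 0 := by
  apply h.linear_ne_zero
  rintro ⟨h0, h1⟩
  apply M.det_ne_zero
  rw [Matrix.det_fin_two, h0, h1]
  ring

theorem quadratic_eq_zero (h : IsHyperellipticFunctionField k F K x y) {a b c : k}
    (h0 : algebraMap k K a * x ^ 2 + algebraMap k K b * x + algebraMap k K c = 0) :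
    a = 0 ∧ b = 0 ∧ c = 0 := by
  have h1 : C a * X ^ 2 + C b * X + C c = 0 := by
    apply transcendental_iff_injective.1 h.transcendental_x
    simpa using h0
  refine ⟨?_, ?_, ?_⟩
  · simpa [coeff_X, coeff_C] using congrArg (coeff · 2) h1
  · simpa [coeff_X, coeff_C] using congrArg (coeff · 1) h1
  · simpa using congrArg (coeff · 0) h1

theorem represents_involution {g : ℕ} {w : K ≃ₐ[k] K} (hwx : w x = x) (hwy : w y = -y) :
    Represents g x y x y w 1 (-1) := by
  constructor <;> simp [hwx, hwy]

theorem x_ne_zero (h : IsHyperellipticFunctionField k F K x y) : x ≠ 0 := by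
  rintro rfl
  exact h.transcendental_x isAlgebraic_zero

theorem y_ne_zero (h : IsHyperellipticFunctionField k F K x y) (hF : F ≠ 0) : y ≠ 0 := by
  rintro rfl
  have := h.sq
  rw [zero_pow two_ne_zero] at this
  exact hF (transcendental_iff.1 h.transcendental_x F this.symm)

theorem map_algEquiv (h : IsHyperellipticFunctionField k F K x y) (σ : K ≃ₐ[k] K) :
    IsHyperellipticFunctionField k F K (σ x) (σ y) where
  transcendental_x := by
    rw [transcendental_iff]
    intro p hp
    rw [aeval_algHom_apply, map_eq_zero_iff σ σ.injective] at hp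
    exact transcendental_iff.1 h.transcendental_x p hp
  sq := by rw [← map_pow, h.sq, aeval_algHom_apply]
  adjoin_eq_top := by
    rw [← Set.image_pair, ← AlgEquiv.coe_toAlgHom, ← IntermediateField.adjoin_map, h.adjoin_eq_top,
      ← AlgHom.fieldRange_eq_map, AlgEquiv.fieldRange_eq_top]

theorem algEquiv_ext (h : IsHyperellipticFunctionField k F K x y) {σ τ : K ≃ₐ[k] K}
    (hx : σ x = τ x) (hy : σ y = τ y) : σ = τ := by
  ext f
  have hf : f ∈ IntermediateField.adjoin k ({x, y} : Set K) := by
    rw [h.adjoin_eq_top]; trivial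
  induction hf using IntermediateField.adjoin_induction with
  | mem z hz => rcases hz with rfl | rfl <;> assumption
  | algebraMap c => simp
  | add a b _ _ ha hb => simp [ha, hb]
  | mul a b _ _ ha hb => simp [ha, hb]
  | inv a _ ha => simp [ha]

theorem sq_reflect (h : IsHyperellipticFunctionField k F K x y) {g : ℕ}
    (hu : F.natDegree ≤ 2 * g + 2) :
    (y / x ^ (g + 1)) ^ 2 = aeval x⁻¹ (reflect (2 * g + 2) F) := by
  rw [aeval_reflect hu h.x_ne_zero, ← h.sq, div_pow, ← pow_mul]
  ring_nf

theorem inv_model (h : IsHyperellipticFunctionField k F K x y) {g : ℕ}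
    (hu : F.natDegree ≤ 2 * g + 2) :
    IsHyperellipticFunctionField k (reflect (2 * g + 2) F) K x⁻¹ (y / x ^ (g + 1)) where
  transcendental_x := by
    intro ha
    exact h.transcendental_x (by simpa using ha.inv)
  sq := h.sq_reflect hu
  adjoin_eq_top := by
    rw [eq_top_iff, ← h.adjoin_eq_top, IntermediateField.adjoin_le_iff]
    set L := IntermediateField.adjoin k ({x⁻¹, y / x ^ (g + 1)} : Set K)
    have hx : x ∈ L := by
      rw [← inv_inv x]
      exact inv_mem (IntermediateField.subset_adjoin _ _ (by simp))
    have hy : y ∈ L := by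
      rw [← div_mul_cancel₀ y (pow_ne_zero (g + 1) h.x_ne_zero)]
      exact mul_mem (IntermediateField.subset_adjoin _ _ (by simp)) (pow_mem hx _)
    rintro z (rfl | rfl) <;> assumption

theorem represents_mul (h : IsHyperellipticFunctionField k F K x y) {g : ℕ} {σ τ : K ≃ₐ[k] K}
    {M N : GL (Fin 2) k} {e f : kˣ} (hσ : Represents g x y x y σ M e)
    (hτ : Represents g x y x y τ N f) : Represents g x y x y (σ * τ) (N * M) (f * e) := by
  have hM := h.denom_ne_zero M
  have key : algebraMap k K ((N * M).val 1 0) * x + algebraMap k K ((N * M).val 1 1) =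
      (algebraMap k K (N.val 1 0) * ((algebraMap k K (M.val 0 0) * x + algebraMap k K (M.val 0 1)) /
        (algebraMap k K (M.val 1 0) * x + algebraMap k K (M.val 1 1))) +
        algebraMap k K (N.val 1 1)) *
        (algebraMap k K (M.val 1 0) * x + algebraMap k K (M.val 1 1)) := by
    simp only [Units.val_mul, Matrix.mul_apply, Fin.sum_univ_two, map_add, map_mul]
    field_simp
    ring
  have keyn : algebraMap k K ((N * M).val 0 0) * x + algebraMap k K ((N * M).val 0 1) =
      (algebraMap k K (N.val 0 0) * ((algebraMap k K (M.val 0 0) * x + algebraMap k K (M.val 0 1)) /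
        (algebraMap k K (M.val 1 0) * x + algebraMap k K (M.val 1 1))) +
        algebraMap k K (N.val 0 1)) *
        (algebraMap k K (M.val 1 0) * x + algebraMap k K (M.val 1 1)) := by
    simp only [Units.val_mul, Matrix.mul_apply, Fin.sum_univ_two, map_add, map_mul]
    field_simp
    ring
  constructor
  · rw [AlgEquiv.mul_apply, hτ.1, keyn, key, mul_div_mul_right _ _ hM]
    simp only [map_div₀, map_add, map_mul, AlgEquiv.commutes, hσ.1]
  · rw [AlgEquiv.mul_apply, hτ.2]
    rw [key, mul_pow]
    simp only [map_div₀, map_add, map_mul, map_pow, AlgEquiv.commutes, hσ.1, hσ.2, Units.val_mul]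
    rw [mul_div_assoc', div_div, mul_comm (_ ^ (g + 1)), mul_assoc]

theorem eq_smul_of_represents (h : IsHyperellipticFunctionField k F K x y) (hF : F ≠ 0) {g : ℕ}
    {σ : K ≃ₐ[k] K} {M N : GL (Fin 2) k} {e f : kˣ} (hM : Represents g x y x y σ M e)
    (hN : Represents g x y x y σ N f) :
    ∃ l : k, N.val = l • M.val ∧ (f : k) = l ^ (g + 1) * e := by
  have hM0 := h.denom_ne_zero M
  have hN0 := h.denom_ne_zero N
  have hdet := M.det_ne_zero
  have e₁ := hM.1.symm.trans hN.1
  rw [div_eq_div_iff hM0 hN0] at e₁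
  rw [Matrix.det_fin_two] at hdet
  obtain ⟨h2, h1, h0⟩ := h.quadratic_eq_zero
    (a := M.val 0 0 * N.val 1 0 - N.val 0 0 * M.val 1 0)
    (b := M.val 0 0 * N.val 1 1 + M.val 0 1 * N.val 1 0 -
      N.val 0 0 * M.val 1 1 - N.val 0 1 * M.val 1 0)
    (c := M.val 0 1 * N.val 1 1 - N.val 0 1 * M.val 1 1) (by
      simp only [map_sub, map_add, map_mul]
      linear_combination e₁)
  have hz : M.val 0 0 * N.val 0 1 - N.val 0 0 * M.val 0 1 = 0 := by
    apply (mul_eq_zero.1 _).resolve_left hdet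
    linear_combination M.val 0 0 * M.val 0 1 * h1 - M.val 0 0 ^ 2 * h0 - M.val 0 1 ^ 2 * h2
  have hz' : N.val 1 0 * M.val 1 1 - N.val 1 1 * M.val 1 0 = 0 := by
    apply (mul_eq_zero.1 _).resolve_left hdet
    linear_combination M.val 1 1 ^ 2 * h2 + M.val 1 0 ^ 2 * h0 - M.val 1 0 * M.val 1 1 * h1
  have hl : N.val = ((N.val 0 0 * M.val 1 1 - N.val 0 1 * M.val 1 0) /
      (M.val 0 0 * M.val 1 1 - M.val 0 1 * M.val 1 0)) • M.val := by
    ext i j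
    rw [Matrix.smul_apply, smul_eq_mul, div_mul_eq_mul_div, eq_div_iff hdet]
    fin_cases i <;> fin_cases j <;> simp only [Fin.zero_eta, Fin.mk_one]
    · linear_combination M.val 1 0 * hz
    · linear_combination M.val 1 1 * hz
    · linear_combination -M.val 1 0 * h1 + 2 * M.val 1 1 * h2 - M.val 0 0 * hz'
    · linear_combination M.val 1 1 * h1 - M.val 0 1 * hz' - 2 * M.val 1 0 * h0
  refine ⟨_, hl, ?_⟩
  have e₂ := hM.2.symm.trans hN.2
  generalize (N.val 0 0 * M.val 1 1 - N.val 0 1 * M.val 1 0) /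
      (M.val 0 0 * M.val 1 1 - M.val 0 1 * M.val 1 0) = l at hl
  have hNl : algebraMap k K (N.val 1 0) * x + algebraMap k K (N.val 1 1) = algebraMap k K l *
      (algebraMap k K (M.val 1 0) * x + algebraMap k K (M.val 1 1)) := by
    rw [hl]
    simp only [Matrix.smul_apply, smul_eq_mul, map_mul]
    ring
  apply (algebraMap k K).injective
  rw [div_eq_div_iff (pow_ne_zero _ hM0) (pow_ne_zero _ hN0), hNl, mul_pow] at e₂
  apply mul_right_cancel₀ (mul_ne_zero (h.y_ne_zero hF) (pow_ne_zero (g + 1) hM0))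
  simp only [map_mul, map_pow]
  linear_combination -e₂

theorem eq_of_represents (h : IsHyperellipticFunctionField k F K x y) {g : ℕ}
    {σ τ : K ≃ₐ[k] K} {M N : GL (Fin 2) k} {e f : kˣ} (hσ : Represents g x y x y σ M e)
    (hτ : Represents g x y x y τ N f) {l : k} (hMN : N.val = l • M.val)
    (hef : (f : k) = l ^ (g + 1) * e) : σ = τ := by
  have hM0 := h.denom_ne_zero M
  have hN0 := h.denom_ne_zero N
  have hl : algebraMap k K l ≠ 0 := by
    intro hl
    apply f.ne_zero
    rw [hef, (map_eq_zero _).1 hl]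
    simp
  have hNl : algebraMap k K (N.val 1 0) * x + algebraMap k K (N.val 1 1) = algebraMap k K l *
      (algebraMap k K (M.val 1 0) * x + algebraMap k K (M.val 1 1)) := by
    rw [hMN]
    simp only [Matrix.smul_apply, smul_eq_mul, map_mul]
    ring
  refine h.algEquiv_ext ?_ ?_
  · rw [hσ.1, hτ.1, hNl, hMN]
    simp only [Matrix.smul_apply, smul_eq_mul, map_mul]
    field_simp
  · rw [hσ.2, hτ.2, hNl, hef]
    simp only [map_mul, map_pow, mul_pow]
    field_simp

theorem aeval_div_eq_zero (h : IsHyperellipticFunctionField k F K x y) {g : ℕ}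
    (hu : F.natDegree ≤ 2 * g + 2) {σ : K ≃ₐ[k] K} {M : GL (Fin 2) k} {e : kˣ}
    (hσ : Represents g x y x y σ M e) {L : Type*} [Field L] [Algebra k L] {r : L}
    (hr : aeval r F = 0) (hq : algebraMap k L (M.val 1 0) * r + algebraMap k L (M.val 1 1) ≠ 0) :
    aeval ((algebraMap k L (M.val 0 0) * r + algebraMap k L (M.val 0 1)) /
      (algebraMap k L (M.val 1 0) * r + algebraMap k L (M.val 1 1))) F = 0 := by
  have hp : ∑ i ∈ Finset.range (2 * g + 2 + 1), F.coeff i •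
      ((C (M.val 0 0) * X + C (M.val 0 1)) ^ i *
        (C (M.val 1 0) * X + C (M.val 1 1)) ^ (2 * g + 2 - i)) = C ((e : k) ^ 2) * F := by
    apply transcendental_iff_injective.1 h.transcendental_x
    have hM := h.denom_ne_zero M
    have e₁ := aeval_mul_pow hu (div_mul_cancel₀ (algebraMap k K (M.val 0 0) * x +
      algebraMap k K (M.val 0 1)) hM)
    rw [← hσ.1, ← (h.map_algEquiv σ).sq, hσ.2] at e₁
    simp only [map_sum, map_smul, map_mul, map_pow, map_add, aeval_C, aeval_X]
    rw [← e₁, ← h.sq, div_pow, ← pow_mul, show (g + 1) * 2 = 2 * g + 2 by ring,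
      div_mul_cancel₀ _ (pow_ne_zero _ hM), mul_pow]
  have e₂ := aeval_mul_pow hu (div_mul_cancel₀ (algebraMap k L (M.val 0 0) * r +
    algebraMap k L (M.val 0 1)) hq)
  have e₃ := congrArg (aeval r) hp
  simp only [map_sum, map_smul, map_mul, map_pow, map_add, aeval_C, aeval_X] at e₃
  rw [e₃, hr, mul_zero] at e₂
  exact (mul_eq_zero.1 e₂).resolve_right (pow_ne_zero _ hq)

theorem apply_x_eq_of_represents (h : IsHyperellipticFunctionField k F K x y) {g : ℕ}
    {σ τ : K ≃ₐ[k] K} {M N : GL (Fin 2) k} {e f : kˣ}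
    (hσ : Represents g x y x y σ M e) (hτ : Represents g x y x y τ N f)
    {L : Type*} [Field L] [Algebra k L] {s : Finset L} (hs : 2 < s.card)
    (hMN : ∀ r ∈ s, (algebraMap k L (M.val 0 0) * r + algebraMap k L (M.val 0 1)) *
      (algebraMap k L (N.val 1 0) * r + algebraMap k L (N.val 1 1)) =
      (algebraMap k L (N.val 0 0) * r + algebraMap k L (N.val 0 1)) *
      (algebraMap k L (M.val 1 0) * r + algebraMap k L (M.val 1 1))) : σ x = τ x := by
  set p : k[X] := (C (M.val 0 0) * X + C (M.val 0 1)) * (C (N.val 1 0) * X + C (N.val 1 1)) -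
      (C (N.val 0 0) * X + C (N.val 0 1)) * (C (M.val 1 0) * X + C (M.val 1 1)) with hp
  have hdeg : p.natDegree ≤ 2 :=
    (natDegree_sub_le_of_le (natDegree_mul_le_of_le natDegree_linear_le natDegree_linear_le)
      (natDegree_mul_le_of_le natDegree_linear_le natDegree_linear_le)).trans (by simp)
  have hp0 : p = 0 := by
    rw [← Polynomial.map_eq_zero (algebraMap k L)]
    refine eq_zero_of_natDegree_lt_card_of_eval_eq_zero' _ s (fun r hr ↦ ?_)
      (natDegree_map_le.trans_lt (hdeg.trans_lt hs))
    rw [eval_map_algebraMap, hp]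
    simp only [map_sub, map_mul, map_add, aeval_C, aeval_X]
    rw [hMN r hr, sub_self]
  have := congrArg (aeval x) hp0
  rw [hp] at this
  simp only [map_sub, map_mul, map_add, aeval_C, aeval_X, map_zero] at this
  rw [hσ.1, hτ.1, div_eq_div_iff (h.denom_ne_zero M) (h.denom_ne_zero N)]
  exact sub_eq_zero.1 this

end IsHyperellipticFunctionField

end

section Automorphism

variable {k K : Type*} [Field k] [CharZero k] [Field K] [Algebra k K]

namespace IsHyperellipticFunctionField

variable {F : k[X]} {x y : K}

theorem exists_derivation (h : IsHyperellipticFunctionField k F K x y) (hF : Squarefree F)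
    (hd : 0 < F.natDegree) : ∃ D : Derivation k K K, D x = 1 := by
  let : Algebra k[X] K := (aeval x : k[X] →ₐ[k] K).toAlgebra
  have : FaithfulSMul k[X] K := (faithfulSMul_iff_algebraMap_injective k[X] K).2
    (transcendental_iff_injective.1 h.transcendental_x)
  have : IsScalarTower k k[X] K := .of_algebraMap_eq fun c ↦ (aeval_C x c).symm
  obtain ⟨D, hD⟩ := exists_derivation_of_exists_quotient (h.exists_quotient hF hd)
  exact ⟨D, by rwa [show algebraMap k[X] K X = x from aeval_X x] at hD⟩

theorem exists_differential_eq (h : IsHyperellipticFunctionField k F K x y) (hF : Squarefree F)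
    (hd : 0 < F.natDegree) {w : K →ₐ[k] K} (hwx : w x = x) (hwy : w y = -y)
    {D : Derivation k K K} (hD : D x = 1)
    {g i : ℕ} (hi : i + 1 ≤ g) {F₁ F₂ : k[X]} {s t : K}
    (hF₁ : Squarefree F₁) (hF₂ : Squarefree F₂) (hs : s ^ 2 = aeval t F₁) (hs0 : s ≠ 0)
    (ht0 : t ≠ 0) (hs' : (s / t ^ (g + 1)) ^ 2 = aeval t⁻¹ F₂) :
    ∃ P Q : k[X], t ^ i * (y * D t / s) = aeval x P + aeval x Q * y := by
  let : Algebra k[X] K := (aeval x : k[X] →ₐ[k] K).toAlgebra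
  have hmap (p : k[X]) : algebraMap k[X] K p = aeval x p := rfl
  have : FaithfulSMul k[X] K := (faithfulSMul_iff_algebraMap_injective k[X] K).2
    (transcendental_iff_injective.1 h.transcendental_x)
  have : IsScalarTower k k[X] K := .of_algebraMap_eq fun c ↦ (aeval_C x c).symm
  let w' : K →ₐ[k[X]] K :=
    { (w : K →+* K) with
      commutes' := fun p ↦ by
        change w (aeval x p) = aeval x p
        rw [← aeval_algHom_apply, hwx] }
  have hgen := h.exists_quotient hF hd
  have hmem {f : K} (hf : f ∈ integralClosure k[X] K) :
      ∃ P Q : k[X], f = aeval x P + aeval x Q * y :=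
    exists_eq_add_mul_of_isIntegral hF h.sq w' hwy hgen hf
  have hx (p : k[X]) : aeval x p ∈ integralClosure k[X] K :=
    (isIntegral_algebraMap : IsIntegral k[X] (algebraMap k[X] K p))
  have hy : y ∈ integralClosure k[X] K := .of_pow two_pos (h.sq ▸ hx F)
  have hDy : 2 * y * D y = aeval x (derivative F) := by
    have := congrArg D h.sq
    rw [D.map_aeval, D.leibniz_pow, hD] at this
    simpa [smul_eq_mul, mul_assoc] using this
  have hyD {f : K} (hf : f ∈ integralClosure k[X] K) : y * D f ∈ integralClosure k[X] K := by
    obtain ⟨P, Q, rfl⟩ := hmem hf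
    have h2 : aeval x (C (1 / 2 : k)) * 2 = (1 : K) := by
      rw [aeval_C, ← map_ofNat (algebraMap k K) 2, ← map_mul]
      simp
    have : y * D (aeval x P + aeval x Q * y) = aeval x (derivative P) * y +
        aeval x (derivative Q * F) + aeval x (Q * C (1 / 2) * derivative F) := by
      rw [D.map_add, D.leibniz, D.map_aeval, D.map_aeval, hD]
      simp only [smul_eq_mul, map_mul, ← h.sq, ← hDy]
      linear_combination -aeval x Q * y * D y * h2
    rw [this]
    exact add_mem (add_mem (mul_mem (hx _) hy) (hx _)) (hx _)
  refine hmem (mem_integralClosure_of_valuation_le_one hgen fun O hO hfrac ↦ ?_)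
  have hk (c : k) : algebraMap k K c ∈ O := hO _ (by simpa using hx (C c))
  refine ValuationSubring.pow_mul_derivation_div_mem hi hF₁ hF₂ hk (fun a ha ↦ ?_) hs hs0 ht0 hs'
  obtain ⟨n, hn, d, hd, hd0, hdO, e⟩ := hfrac a ha
  have e' := congrArg D e
  rw [D.leibniz, smul_eq_mul, smul_eq_mul] at e'
  have : y * D a = d⁻¹ * (y * D n - a * (y * D d)) := by
    field_simp
    linear_combination y * e'
  rw [this]
  exact O.mul_mem _ _ hdO (O.sub_mem (hO _ (hyD hn)) (O.mul_mem _ _ ha (hO _ (hyD hd))))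

theorem derivation_eq_zero (h : IsHyperellipticFunctionField k F K x y) (hF : F ≠ 0)
    {D : Derivation k K K} (hD : D x = 0) : D = 0 := by
  have hy : D y = 0 := by
    have : CharZero K := charZero_of_injective_algebraMap (algebraMap k K).injective
    have := congrArg D h.sq
    rw [D.map_aeval, D.leibniz_pow, hD] at this
    simpa [h.y_ne_zero hF] using this
  ext f
  have hf : f ∈ IntermediateField.adjoin k ({x, y} : Set K) := by
    rw [h.adjoin_eq_top]; trivial
  induction hf using IntermediateField.adjoin_induction with
  | mem z hz => rcases hz with rfl | rfl <;> assumption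
  | algebraMap c => simp
  | add a b _ _ ha hb => simp [ha, hb]
  | mul a b _ _ ha hb => simp [ha, hb]
  | inv a _ ha => simp [D.leibniz_inv, ha]

theorem eq_and_eq_of_add_mul_eq (h : IsHyperellipticFunctionField k F K x y) (hF : F ≠ 0)
    {w : K →ₐ[k] K} (hwx : w x = x) (hwy : w y = -y) {A B A' B' : k[X]}
    (e : aeval x A + aeval x B * y = aeval x A' + aeval x B' * y) : A = A' ∧ B = B' := by
  have : CharZero K := charZero_of_injective_algebraMap (algebraMap k K).injective
  have ew := congrArg w e
  simp only [map_add, map_mul, ← aeval_algHom_apply, hwx, hwy] at ew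
  have hinj := transcendental_iff_injective.1 h.transcendental_x
  constructor
  · apply hinj
    linear_combination (e + ew) / 2
  · apply hinj
    apply mul_right_cancel₀ (h.y_ne_zero hF)
    linear_combination (e - ew) / 2

theorem exists_holomorphic_differential_eq (h : IsHyperellipticFunctionField k F K x y)
    (hF : Squarefree F) {g i : ℕ} (hl : 2 * g + 1 ≤ F.natDegree) (hu : F.natDegree ≤ 2 * g + 2)
    {w : K →ₐ[k] K} (hwx : w x = x) (hwy : w y = -y)
    {D : Derivation k K K} (hD : D x = 1) (hi : i + 1 ≤ g) {F₁ F₂ : k[X]} {s t : K}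
    (hF₁ : Squarefree F₁) (hF₂ : Squarefree F₂) (hs : s ^ 2 = aeval t F₁) (hs0 : s ≠ 0)
    (ht0 : t ≠ 0) (hs' : (s / t ^ (g + 1)) ^ 2 = aeval t⁻¹ F₂) :
    ∃ P : k[X], P.natDegree + 1 ≤ g ∧ t ^ i * (y * D t / s) = aeval x P := by
  have hx0 := h.x_ne_zero
  obtain ⟨P, Q, e⟩ := h.exists_differential_eq hF (by omega) hwx hwy hD hi hF₁ hF₂ hs hs0 ht0 hs'
  have hD' : (-(x ^ 2) • D) x⁻¹ = 1 := by
    rw [Derivation.smul_apply, D.leibniz_inv, hD]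
    simp only [smul_eq_mul]
    field_simp
  obtain ⟨P', Q', e'⟩ := (h.inv_model hu).exists_differential_eq (squarefree_reflect hF hl hu)
    (natDegree_reflect_pos hF g) (w := w) (by rw [map_inv₀, hwx])
    (by rw [map_div₀, map_pow, hwx, hwy, neg_div]) hD' hi hF₁ hF₂ hs hs0 ht0 hs'
  obtain ⟨N, hN₁, hN₂⟩ : ∃ N, P'.natDegree ≤ N ∧ Q'.natDegree ≤ N :=
    ⟨_, le_max_left _ _, le_max_right _ _⟩
  have hP' := aeval_reflect hN₁ (inv_ne_zero hx0)
  have hQ' := aeval_reflect hN₂ (inv_ne_zero hx0)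
  rw [inv_inv] at hP' hQ'
  have key : aeval x (-(X ^ (N + 2) * P)) + aeval x (-(X ^ (N + 2) * Q)) * y =
      aeval x (X ^ (g + 1) * reflect N P') + aeval x (reflect N Q') * y := by
    simp only [map_neg, map_mul, map_pow, aeval_X, hP', hQ']
    have e1 : -(x ^ 2) * (aeval x P + aeval x Q * y) =
        x ^ (g + 1) * aeval x⁻¹ P' + aeval x⁻¹ Q' * y := by
      have : x ^ (g + 1) * (aeval x⁻¹ P' + aeval x⁻¹ Q' * (y / x ^ (g + 1))) =
          x ^ (g + 1) * aeval x⁻¹ P' + aeval x⁻¹ Q' * y := by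
        field_simp
      rw [← this, ← e', ← e, Derivation.smul_apply, smul_eq_mul]
      field_simp
    rw [inv_pow, div_inv_eq_mul, div_inv_eq_mul]
    linear_combination x ^ N * e1
  obtain ⟨hP, hQ⟩ := h.eq_and_eq_of_add_mul_eq hF.ne_zero hwx hwy key
  have hdeg {R : k[X]} (hR : R.natDegree ≤ N) : (reflect N R).natDegree ≤ N :=
    natDegree_reflect_le.trans (max_le le_rfl hR)
  have hQ0 : Q = 0 := by
    by_contra hQ0
    have := congrArg natDegree hQ
    rw [natDegree_neg, natDegree_mul (pow_ne_zero _ X_ne_zero) hQ0, natDegree_X_pow] at this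
    have := hdeg hN₂
    omega
  refine ⟨P, ?_, by rw [e, hQ0]; simp⟩
  rcases eq_or_ne P 0 with rfl | hP0
  · rw [natDegree_zero]; omega
  have := congrArg natDegree hP
  rw [natDegree_neg, natDegree_mul (pow_ne_zero _ X_ne_zero) hP0, natDegree_X_pow] at this
  have h1 := natDegree_mul_le (p := (X : k[X]) ^ (g + 1)) (q := reflect N P')
  rw [natDegree_X_pow] at h1
  have := hdeg hN₁
  omega

theorem exists_represents (h : IsHyperellipticFunctionField k F K x y) {g : ℕ} (hg : 2 ≤ g)
    (hF : Squarefree F) (hl : 2 * g + 1 ≤ F.natDegree) (hu : F.natDegree ≤ 2 * g + 2)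
    {w : K →ₐ[k] K} (hwx : w x = x) (hwy : w y = -y) (σ : K ≃ₐ[k] K) :
    ∃ (M : GL (Fin 2) k) (e : kˣ), Represents g x y x y σ M e := by
  obtain ⟨D, hD⟩ := h.exists_derivation hF (by omega)
  have hσ := h.map_algEquiv σ
  have hinj := transcendental_iff_injective.1 h.transcendental_x
  have hy0 := h.y_ne_zero hF.ne_zero
  have hs0 := hσ.y_ne_zero hF.ne_zero
  have ht0 := hσ.x_ne_zero
  have hDt : D (σ x) ≠ 0 := fun h0 ↦ by
    have := congrArg (· x) (hσ.derivation_eq_zero hF.ne_zero h0)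
    simp [hD] at this
  have hpoly {i : ℕ} (hi : i + 1 ≤ g) := h.exists_holomorphic_differential_eq hF hl hu hwx hwy hD hi
    hF (squarefree_reflect hF hl hu) hσ.sq hs0 ht0 (hσ.sq_reflect hu)
  obtain ⟨m, rfl⟩ := Nat.exists_eq_add_of_le' (show 1 ≤ g by omega)
  obtain ⟨H₀, hH₀, e₀⟩ := hpoly (i := 0) (by omega)
  obtain ⟨H₁, -, e₁⟩ := hpoly (i := 1) (by omega)
  obtain ⟨H, hH, e⟩ := hpoly (i := m) le_rfl
  unfold Represents
  generalize σ x = t at *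
  generalize σ y = s at *
  rw [pow_zero, one_mul] at e₀
  rw [e₀, pow_one] at e₁
  rw [e₀] at e
  have hH₀0 : H₀ ≠ 0 := by
    rintro rfl
    simp [hy0, hs0, hDt] at e₀
  obtain ⟨d, P, Q, hd, hco, rfl, rfl⟩ := exists_isCoprime_eq_mul H₁ hH₀0
  have hne {p : k[X]} (hp : p ≠ 0) : aeval x p ≠ 0 := by
    rwa [Ne, map_eq_zero_iff _ hinj]
  have hQ0 : Q ≠ 0 := right_ne_zero_of_mul hH₀0
  have htQ : t * aeval x Q = aeval x P := by
    apply mul_left_cancel₀ (hne hd)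
    simp only [map_mul] at e₁
    linear_combination e₁
  have hP0 : P ≠ 0 := by
    rintro rfl
    rw [map_zero] at htQ
    exact mul_ne_zero ht0 (hne hQ0) htQ
  have hPH : P ^ m * (d * Q) = Q ^ m * H := by
    apply hinj
    rw [map_mul, map_pow, ← htQ, map_mul (aeval x) (Q ^ m), ← e, map_pow]
    ring
  obtain ⟨c, hc⟩ : Q ^ m ∣ d * Q := hco.symm.pow.dvd_of_dvd_mul_left ⟨H, hPH⟩
  have hHc : H = P ^ m * c := by
    apply mul_left_cancel₀ (pow_ne_zero m hQ0)
    rw [← hPH, hc]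
    ring
  have hc0 : c ≠ 0 := by
    rintro rfl
    simp [hH₀0] at hc
  rw [hc, natDegree_mul (pow_ne_zero m hQ0) hc0, natDegree_pow] at hH₀
  rw [hHc, natDegree_mul (pow_ne_zero m hP0) hc0, natDegree_pow] at hH
  have hQ1 : Q.natDegree ≤ 1 := by
    by_contra! hlt
    nlinarith
  have hP1 : P.natDegree ≤ 1 := by
    by_contra! hlt
    nlinarith
  obtain ⟨a, b, hP⟩ := exists_eq_X_add_C_of_natDegree_le_one hP1
  obtain ⟨a', b', hQ⟩ := exists_eq_X_add_C_of_natDegree_le_one hQ1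
  have hQx : aeval x Q = algebraMap k K a' * x + algebraMap k K b' := by
    rw [hQ]; simp
  have hPx : aeval x P = algebraMap k K a * x + algebraMap k K b := by
    rw [hP]; simp
  have hq := hne hQ0
  rw [hQx] at hq
  have hdet : D t * (algebraMap k K a' * x + algebraMap k K b') ^ 2 =
      algebraMap k K (a * b' - b * a') := by
    rw [hQx, hPx] at htQ
    have := congrArg D htQ
    simp only [D.leibniz, D.map_add, D.map_algebraMap, hD, smul_eq_mul] at this
    simp only [map_sub, map_mul]
    linear_combination (algebraMap k K a' * x + algebraMap k K b') * this -
      algebraMap k K a' * htQ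
  have hdet0 : a * b' - b * a' ≠ 0 := by
    intro h0
    rw [h0, map_zero] at hdet
    exact mul_ne_zero hDt (pow_ne_zero 2 hq) hdet
  have hcdeg : c.natDegree = 0 := by
    by_contra hc1
    have hP2 : P.natDegree = 0 := by
      by_contra hP2
      have := Nat.mul_le_mul_left m (Nat.one_le_iff_ne_zero.2 hP2)
      omega
    have hQ2 : Q.natDegree = 0 := by
      by_contra hQ2
      have := Nat.mul_le_mul_left m (Nat.one_le_iff_ne_zero.2 hQ2)
      omega
    have ha : a = 0 := by
      have := coeff_eq_zero_of_natDegree_lt (show P.natDegree < 1 by omega)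
      rw [hP] at this
      simpa using this
    have ha' : a' = 0 := by
      have := coeff_eq_zero_of_natDegree_lt (show Q.natDegree < 1 by omega)
      rw [hQ] at this
      simpa using this
    simp [ha, ha'] at hdet0
  obtain ⟨c₀, rfl⟩ := natDegree_eq_zero.1 hcdeg
  have hc₀ : c₀ ≠ 0 := by simpa using hc0
  have hc₀' : algebraMap k K c₀ ≠ 0 := by simpa using hc₀
  refine ⟨Matrix.GeneralLinearGroup.mkOfDetNeZero !![a, b; a', b']
    (by rwa [Matrix.det_fin_two_of]), Units.mk0 ((a * b' - b * a') / c₀)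
    (div_ne_zero hdet0 hc₀), ?_, ?_⟩
  · rw [hQx, hPx] at htQ
    simpa using eq_div_of_mul_eq hq htQ
  · rw [hc, map_mul, map_pow, aeval_C, hQx, div_eq_iff hs0] at e₀
    simp only [Matrix.GeneralLinearGroup.mkOfDetNeZero, Units.val_mk0]
    trans algebraMap k K ((a * b' - b * a') / c₀) * y /
      (algebraMap k K a' * x + algebraMap k K b') ^ (m + 1 + 1)
    · rw [map_div₀, ← hdet, eq_div_iff (pow_ne_zero _ hq), div_mul_eq_mul_div, eq_div_iff hc₀']
      linear_combination -(algebraMap k K a' * x + algebraMap k K b') ^ 2 * e₀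
    · simp

theorem finite_algEquiv (h : IsHyperellipticFunctionField k F K x y) {g : ℕ} (hg : 2 ≤ g)
    (hF : Squarefree F) (hl : 2 * g + 1 ≤ F.natDegree) (hu : F.natDegree ≤ 2 * g + 2)
    {w : K ≃ₐ[k] K} (hwx : w x = x) (hwy : w y = -y) : Finite (K ≃ₐ[k] K) := by
  classical
  choose M e hMe using h.exists_represents hg hF hl hu (w := w) hwx hwy
  let L := AlgebraicClosure k
  have hcard : 2 < (F.rootSet L).toFinset.card := by
    rw [Set.toFinset_card, card_rootSet_eq_natDegree (PerfectField.separable_iff_squarefree.2 hF)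
      (IsAlgClosed.splits _)]
    omega
  let θ (σ : K ≃ₐ[k] K) (r : F.rootSet L) : Option L :=
    if algebraMap k L ((M σ).val 1 0) * r + algebraMap k L ((M σ).val 1 1) = 0 then none
    else some ((algebraMap k L ((M σ).val 0 0) * r + algebraMap k L ((M σ).val 0 1)) /
      (algebraMap k L ((M σ).val 1 0) * r + algebraMap k L ((M σ).val 1 1)))
  have hθ : {f : F.rootSet L → Option L |
      ∀ r, f r ∈ insert none (some '' F.rootSet L)}.Finite :=
    .pi' fun r ↦ ((F.rootSet_finite L).image _).insert _
  have hpre := hθ.preimage' (f := θ) fun f _ ↦ ?_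
  · refine Set.finite_univ_iff.1 (hpre.subset fun σ _ r ↦ ?_)
    by_cases hq : algebraMap k L ((M σ).val 1 0) * r + algebraMap k L ((M σ).val 1 1) = 0
    · simp [θ, hq]
    · simp only [θ, hq, if_false]
      exact .inr ⟨_, (mem_rootSet.2 ⟨hF.ne_zero,
        h.aeval_div_eq_zero hu (hMe σ) (mem_rootSet.1 r.2).2 hq⟩), rfl⟩
  rcases (θ ⁻¹' {f}).eq_empty_or_nonempty with he | ⟨τ, hτ⟩
  · simp [he]
  refine (Set.toFinite {τ, τ * w}).subset fun σ hσ ↦ ?_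
  have hστ : θ σ = θ τ := hσ.trans hτ.symm
  have hx : σ x = τ x := by
    refine h.apply_x_eq_of_represents (hMe σ) (hMe τ) hcard fun r hr ↦ ?_
    have := congrFun hστ ⟨r, by simpa using hr⟩
    simp only [θ] at this
    split_ifs at this with h₁ h₂ h₂
    · rw [h₁, h₂, mul_zero, mul_zero]
    · exact (div_eq_div_iff h₁ h₂).1 (Option.some.inj this)
  have hy : (σ y) ^ 2 = (τ y) ^ 2 := by
    rw [(h.map_algEquiv σ).sq, (h.map_algEquiv τ).sq, hx]
  rcases sq_eq_sq_iff_eq_or_eq_neg.1 hy with hy | hy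
  · exact .inl (h.algEquiv_ext hx hy)
  · exact .inr (h.algEquiv_ext (by simp [hwx, hx]) (by simp [hwy, hy]))

end IsHyperellipticFunctionField

end Automorphism

theorem DihedralGroup.exists_injective_monoidHom {Γ : Type*} [Group Γ] {n : ℕ} (ε : Γ →* ℤˣ)
    (φ : Γ → ZMod n) (hφ : ∀ σ τ, ε σ = 1 → ε τ = 1 → φ (σ * τ) = φ σ + φ τ)
    (hinj : ∀ σ, ε σ = 1 → φ σ = 0 → σ = 1) (hε : ∀ σ, ε σ = -1 → σ * σ = 1) :
    ∃ f : Γ →* DihedralGroup n, Function.Injective f := by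
  obtain ⟨s, hs⟩ : ∃ s, ∀ σ, ε σ ≠ 1 → ε s = -1 := by
    by_cases h : ∃ s, ε s = -1
    · obtain ⟨s, hs⟩ := h
      exact ⟨s, fun _ _ ↦ hs⟩
    · exact ⟨1, fun σ hσ ↦ (h ⟨σ, (Int.units_eq_one_or _).resolve_left hσ⟩).elim⟩
  have hneg {σ : Γ} (hσ : ε σ ≠ 1) : ε σ = -1 := (Int.units_eq_one_or _).resolve_left hσ
  have hsσ {σ : Γ} (hσ : ε σ ≠ 1) : ε (s * σ) = 1 := by rw [map_mul, hs σ hσ, hneg hσ]; rfl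
  have hinv (σ τ : Γ) (hσ : ε σ = 1) (hτ : ε τ = 1) (h : φ σ = φ τ) : σ = τ := by
    have hτ' : ε τ⁻¹ = 1 := by rw [map_inv, hτ, inv_one]
    have h1 : φ (τ * τ⁻¹) = φ (σ * τ⁻¹) := by rw [hφ _ _ hτ hτ', hφ _ _ hσ hτ', h]
    have h0 : φ (1 : Γ) = 0 := by simpa using hφ 1 1 (map_one ε) (map_one ε)
    rw [mul_inv_cancel, h0] at h1
    exact mul_inv_eq_one.1 (hinj _ (by rw [map_mul, hσ, hτ', one_mul]) h1.symm)
  have hsub (σ τ : Γ) (hσ : ε σ = 1) (hτ : ε (σ * τ) = 1) : φ τ = φ (σ * τ) - φ σ := by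
    rw [hφ σ τ hσ (by simpa [hσ] using hτ), add_sub_cancel_left]
  let f : Γ →* DihedralGroup n := .mk' (fun σ ↦ if ε σ = 1 then .r (φ σ) else .sr (φ (s * σ)))
    (fun σ τ ↦ by
      by_cases hσ : ε σ = 1 <;> by_cases hτ : ε τ = 1
      · simp [hσ, hτ, hφ]
      · have h1 : σ * (s * (σ * τ)) = s * τ := by
          have hs2 := hε s (hs τ hτ)
          have := hε (s * σ) (by rw [map_mul, hs τ hτ, hσ, mul_one])
          calc σ * (s * (σ * τ)) = s * s * (σ * (s * (σ * τ))) := by rw [hs2, one_mul]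
            _ = s * (s * σ * (s * σ)) * τ := by simp only [mul_assoc]
            _ = s * τ := by rw [this, mul_one]
        have h2 := hsub σ (s * (σ * τ)) hσ (by rw [h1]; exact hsσ hτ)
        rw [h1] at h2
        simp [hσ, hτ, h2]
      · simp [hσ, hτ, ← hφ _ _ (hsσ hσ) hτ, mul_assoc]
      · have h1 : s * σ * (σ * τ) = s * τ := by
          rw [mul_assoc, ← mul_assoc σ, hε σ (hneg hσ), one_mul]
        have h2 := hsub (s * σ) (σ * τ) (hsσ hσ) (by rw [h1]; exact hsσ hτ)
        rw [h1] at h2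
        simp [hneg hσ, hneg hτ, h2])
  refine ⟨f, fun σ τ h ↦ ?_⟩
  change (if ε σ = 1 then _ else _) = (if ε τ = 1 then _ else _) at h
  split_ifs at h with hσ hτ hτ
  · exact hinv σ τ hσ hτ (DihedralGroup.r.inj h)
  · exact mul_left_cancel (hinv _ _ (hsσ hσ) (hsσ hτ) (DihedralGroup.sr.inj h))

theorem Complex.pow_four_eq_one_or_pow_six_eq_one {z : ℂ} {m : ℕ} (hm : m ≠ 0) (hz : z ^ m = 1)
    {q : ℚ} (hq : z + starRingEnd ℂ z = q) : z ^ 4 = 1 ∨ z ^ 6 = 1 := by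
  have hn : ‖z‖ = 1 := Complex.norm_eq_one_of_pow_eq_one hz hm
  have hzi : IsIntegral ℤ z := .of_pow (Nat.pos_of_ne_zero hm) (hz ▸ isIntegral_one)
  have hqi : IsIntegral ℤ q := by
    have h1 : IsIntegral ℤ (z + starRingEnd ℂ z) :=
      hzi.add (hzi.map ((starRingEnd ℂ).toIntAlgHom))
    rw [hq] at h1
    exact (isIntegral_algebraMap_iff (algebraMap ℚ ℂ).injective).1 h1
  obtain ⟨t, rfl⟩ := IsIntegrallyClosed.isIntegral_iff.1 hqi
  have hc : z * starRingEnd ℂ z = 1 := by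
    rw [Complex.mul_conj, Complex.normSq_eq_norm_sq, hn]; simp
  have ht : |t| ≤ 2 := by
    have h1 : ‖z + starRingEnd ℂ z‖ ≤ 2 := (norm_add_le _ _).trans (by
      rw [Complex.norm_conj, hn]; norm_num)
    rw [hq] at h1
    simp only [eq_intCast, Rat.cast_intCast, Complex.norm_intCast] at h1
    exact_mod_cast h1
  have key : z ^ 2 = t * z - 1 := by
    simp only [eq_intCast, Rat.cast_intCast] at hq
    linear_combination -hc + z * hq
  obtain ⟨h1, h2⟩ := abs_le.1 ht
  interval_cases t
  · have : z = -1 := by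
      have : (z + 1) ^ 2 = 0 := by push_cast at key; linear_combination key
      linear_combination pow_eq_zero_iff (two_ne_zero) |>.1 this
    left; rw [this]; norm_num
  · right
    push_cast at key
    have : z ^ 3 = 1 := by linear_combination (z - 1) * key
    linear_combination (z ^ 3 + 1) * this
  · left
    push_cast at key
    linear_combination (z ^ 2 - 1) * key
  · right
    push_cast at key
    have : z ^ 3 = -1 := by linear_combination (z + 1) * key
    linear_combination (z ^ 3 - 1) * this
  · have : z = 1 := by
      have : (z - 1) ^ 2 = 0 := by push_cast at key; linear_combination key
      linear_combination pow_eq_zero_iff (two_ne_zero) |>.1 this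
    left; rw [this]; norm_num

theorem DihedralGroup.exists_injective_four_or_six {Γ : Type*} [Group Γ] [Finite Γ] (ε : Γ →* ℤˣ)
    (χ : Γ → ℂ) (hχ : ∀ σ τ, ε σ = 1 → ε τ = 1 → χ (σ * τ) = χ σ * χ τ)
    (hχ₁ : χ 1 = 1) (hinj : ∀ σ, ε σ = 1 → χ σ = 1 → σ = 1)
    (hq : ∀ σ, ε σ = 1 → ∃ q : ℚ, χ σ + starRingEnd ℂ (χ σ) = q)
    (hε : ∀ σ, ε σ = -1 → σ * σ = 1) :
    (∃ f : Γ →* DihedralGroup 4, Function.Injective f) ∨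
      ∃ f : Γ →* DihedralGroup 6, Function.Injective f := by
  let ψ : ε.ker →* ℂ :=
    { toFun := fun σ ↦ χ σ
      map_one' := hχ₁
      map_mul' := fun σ τ ↦ hχ _ _ σ.2 τ.2 }
  have hψ : Function.Injective ψ :=
    (injective_iff_map_eq_one _).2 fun σ hσ ↦ Subtype.ext (hinj _ σ.2 hσ)
  have := isCyclic_of_injective_ringHom ψ hψ
  obtain ⟨ρ, hρ⟩ := IsCyclic.exists_generator (α := ε.ker)
  have key {n : ℕ} [NeZero n] (hn : ψ ρ ^ n = 1) :
      ∃ f : Γ →* DihedralGroup n, Function.Injective f := by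
    have hn' (σ : ε.ker) : ψ σ ^ n = 1 := by
      obtain ⟨k, rfl⟩ := hρ σ
      have : ρ ^ n = 1 := hψ (by rw [map_pow, hn, map_one])
      rw [← map_pow, ← zpow_natCast, ← zpow_mul, mul_comm, zpow_mul, zpow_natCast, this, one_zpow,
        map_one]
    let η : rootsOfUnity n ℂ ≃* Multiplicative (ZMod n) := mulEquivOfCyclicCardEq (by
      rw [Complex.card_rootsOfUnity, Nat.card_congr Multiplicative.toAdd,
        Nat.card_zmod])
    let φ (σ : Γ) : ZMod n := if hσ : ε σ = 1 then
      (η (rootsOfUnity.mkOfPowEq (χ σ) (hn' ⟨σ, hσ⟩))).toAdd else 0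
    refine exists_injective_monoidHom ε φ (fun σ τ hσ hτ ↦ ?_) (fun σ hσ h0 ↦ hinj σ hσ ?_) hε
    · have hστ : ε (σ * τ) = 1 := by rw [map_mul, hσ, hτ, one_mul]
      simp only [φ, hσ, hτ, hστ, dif_pos]
      rw [← toAdd_mul, ← map_mul]
      congr 2
      ext
      simp [hχ σ τ hσ hτ]
    · simp only [φ, hσ, dif_pos, toAdd_eq_zero, map_eq_one_iff _ η.injective] at h0
      simpa using congrArg (fun z : rootsOfUnity n ℂ ↦ ((z : ℂˣ) : ℂ)) h0
  obtain ⟨q, hq⟩ := hq ρ ρ.2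
  exact (Complex.pow_four_eq_one_or_pow_six_eq_one (z := ψ ρ) (orderOf_pos ρ).ne'
    (by rw [← map_pow, pow_orderOf_eq_one, map_one]) hq).imp key key

/-- Matrices `M σ` and scalars `e σ`, well defined up to `(M, e) ↦ (l • M, l ^ n * e)`, that
compose contravariantly and determine `σ`. -/
structure IsTwistedRepresentation {G : Type*} [Group G] (n : ℕ) (M : G → Matrix (Fin 2) (Fin 2) ℚ)
    (e : G → ℚ) : Prop where
  det_ne_zero (σ : G) : (M σ).det ≠ 0
  exists_mul (σ τ : G) : ∃ l : ℚ, l ≠ 0 ∧ M τ * M σ = l • M (σ * τ) ∧ e τ * e σ = l ^ n * e (σ * τ)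
  eq_of_smul {σ τ : G} {l : ℚ} : M σ = l • M τ → e σ = l ^ n * e τ → σ = τ
  e_ne_zero (σ : G) : e σ ≠ 0

namespace IsTwistedRepresentation

variable {G : Type*} [Group G] {n : ℕ} {M : G → Matrix (Fin 2) (Fin 2) ℚ} {e : G → ℚ}

theorem subgroup (h : IsTwistedRepresentation n M e) (H : Subgroup G) :
    IsTwistedRepresentation n (fun σ : H ↦ M σ) (fun σ : H ↦ e σ) where
  det_ne_zero σ := h.det_ne_zero σ
  exists_mul σ τ := h.exists_mul σ τ
  eq_of_smul hM he := Subtype.ext (h.eq_of_smul hM he)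
  e_ne_zero σ := h.e_ne_zero σ

theorem exists_det_mul (h : IsTwistedRepresentation n M e) (σ τ : G) :
    ∃ l : ℚ, l ≠ 0 ∧ M τ * M σ = l • M (σ * τ) ∧ e τ * e σ = l ^ n * e (σ * τ) ∧
      (M τ).det * (M σ).det = l ^ 2 * (M (σ * τ)).det := by
  obtain ⟨l, hl, hM, he⟩ := h.exists_mul σ τ
  refine ⟨l, hl, hM, he, ?_⟩
  rw [← Matrix.det_mul, hM, Matrix.det_smul, Fintype.card_fin]

theorem eq_one (h : IsTwistedRepresentation n M e) {σ : G} {l : ℚ} (hM : M σ = l • 1)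
    (he : e σ = l ^ n) : σ = 1 := by
  obtain ⟨m, hm, hm₁, hm₂⟩ := h.exists_mul σ 1
  rw [mul_one, hM, Matrix.mul_smul, mul_one] at hm₁
  rw [mul_one, he] at hm₂
  have hl : l ≠ 0 := by
    rintro rfl
    apply h.det_ne_zero σ
    simp [hM]
  have hm₃ : M 1 = m • 1 := by
    have := congrArg (l⁻¹ • ·) hm₁
    simpa [smul_smul, mul_comm m, hl] using this
  have hm₄ : e 1 = m ^ n := mul_right_cancel₀ (pow_ne_zero n hl) hm₂
  refine h.eq_of_smul (l := l / m) ?_ ?_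
  · rw [hm₃, hM, smul_smul, div_mul_cancel₀ _ hm]
  · rw [hm₄, he, ← mul_pow, div_mul_cancel₀ _ hm]

theorem e_sq (h : IsTwistedRepresentation n M e) [Finite G] (σ : G) :
    e σ ^ 2 = |(M σ).det| ^ n := by
  have h0 (σ : G) := pow_ne_zero n (abs_ne_zero.2 (h.det_ne_zero σ))
  have hmul (σ τ : G) : e (σ * τ) ^ 2 / |(M (σ * τ)).det| ^ n =
      e σ ^ 2 / |(M σ).det| ^ n * (e τ ^ 2 / |(M τ).det| ^ n) := by
    obtain ⟨l, hl, -, he, hd⟩ := h.exists_det_mul σ τ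
    have hd' := congrArg (|·| ^ n) hd
    simp only [abs_mul, mul_pow, abs_sq] at hd'
    rw [div_mul_div_comm, div_eq_div_iff (h0 _) (mul_ne_zero (h0 _) (h0 _))]
    linear_combination e (σ * τ) ^ 2 * hd' -
      |(M (σ * τ)).det| ^ n * (e τ * e σ + l ^ n * e (σ * τ)) * he
  have h1 : e 1 ^ 2 / |(M 1).det| ^ n = 1 := by
    have := hmul 1 1
    rw [mul_one] at this
    exact (mul_eq_left₀ (div_ne_zero (pow_ne_zero 2 (h.e_ne_zero 1)) (h0 1))).1 this.symm
  let ν : G →* ℚ := ⟨⟨fun σ ↦ e σ ^ 2 / |(M σ).det| ^ n, h1⟩, hmul⟩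
  have : ν σ = 1 := by
    change e σ ^ 2 / |(M σ).det| ^ n = 1
    rw [← pow_eq_one_iff_of_nonneg (by positivity : 0 ≤ e σ ^ 2 / |(M σ).det| ^ n)
      (orderOf_pos σ).ne']
    change ν σ ^ _ = 1
    rw [← map_pow, pow_orderOf_eq_one, map_one]
  exact (div_eq_one_iff_eq (h0 σ)).1 this

theorem exists_form (h : IsTwistedRepresentation n M e) [Finite G] :
    ∃ A B C : ℚ, 0 < A ∧ B ^ 2 < A * C ∧ ∀ σ,
      (0 < (M σ).det → A * (M σ 0 0 - M σ 1 1) = -2 * (B * M σ 1 0) ∧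
        A * M σ 0 1 = -(C * M σ 1 0)) ∧
      ((M σ).det < 0 → M σ 0 0 + M σ 1 1 = 0) := by
  have := Fintype.ofFinite G
  set S : Matrix (Fin 2) (Fin 2) ℚ := ∑ σ, |(M σ).det|⁻¹ • ((M σ).transpose * M σ) with hS
  have hsymm : S 1 0 = S 0 1 := by
    simp [hS, Matrix.sum_apply, Matrix.mul_apply, mul_comm]
  have hpos (u v : ℚ) (huv : ¬(u = 0 ∧ v = 0)) :
      0 < S 0 0 * u ^ 2 + 2 * S 0 1 * u * v + S 1 1 * v ^ 2 := by
    have : S 0 0 * u ^ 2 + 2 * S 0 1 * u * v + S 1 1 * v ^ 2 = ∑ σ, |(M σ).det|⁻¹ *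
        ((M σ 0 0 * u + M σ 0 1 * v) ^ 2 + (M σ 1 0 * u + M σ 1 1 * v) ^ 2) := by
      simp only [hS, Matrix.sum_apply, Finset.sum_mul, Finset.mul_sum, ← Finset.sum_add_distrib]
      refine Finset.sum_congr rfl fun σ _ ↦ ?_
      simp [Matrix.mul_apply]
      ring
    rw [this]
    refine Finset.sum_pos (fun σ _ ↦ mul_pos (inv_pos.2 (abs_pos.2 (h.det_ne_zero σ))) ?_)
      ⟨1, by simp⟩
    by_contra hle
    have h1 : M σ 0 0 * u + M σ 0 1 * v = 0 := by nlinarith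
    have h2 : M σ 1 0 * u + M σ 1 1 * v = 0 := by nlinarith
    have hd := h.det_ne_zero σ
    rw [Matrix.det_fin_two] at hd
    refine huv ⟨?_, ?_⟩
    · apply (mul_eq_zero.1 _).resolve_left hd
      linear_combination M σ 1 1 * h1 - M σ 0 1 * h2
    · apply (mul_eq_zero.1 _).resolve_left hd
      linear_combination M σ 0 0 * h2 - M σ 1 0 * h1
  have hA : 0 < S 0 0 := by simpa using hpos 1 0 (by simp)
  have hinv (ρ : G) : (M ρ).transpose * S * M ρ = |(M ρ).det| • S := by
    have hterm (σ : G) : (M ρ).transpose * (|(M σ).det|⁻¹ • ((M σ).transpose * M σ)) * M ρ =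
        |(M ρ).det| • (|(M (ρ * σ)).det|⁻¹ • ((M (ρ * σ)).transpose * M (ρ * σ))) := by
      obtain ⟨l, hl, hm, -, hd⟩ := h.exists_det_mul ρ σ
      have e1 : (M ρ).transpose * ((M σ).transpose * M σ) * M ρ =
          l ^ 2 • ((M (ρ * σ)).transpose * M (ρ * σ)) := by
        rw [← Matrix.mul_assoc, ← Matrix.transpose_mul, Matrix.mul_assoc, hm,
          Matrix.transpose_smul, Matrix.smul_mul, Matrix.mul_smul, smul_smul, sq]
      rw [Matrix.mul_smul, Matrix.smul_mul, e1, smul_smul, smul_smul]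
      congr 1
      have hd' := congrArg (|·|) hd
      simp only [abs_mul, abs_pow, sq_abs] at hd'
      have h1 := abs_ne_zero.2 (h.det_ne_zero σ)
      have h2 := abs_ne_zero.2 (h.det_ne_zero (ρ * σ))
      field_simp
      linear_combination -hd'
    rw [hS, Finset.mul_sum, Finset.sum_mul, Finset.smul_sum]
    simp only [hterm]
    exact Fintype.sum_equiv (Equiv.mulLeft ρ) _ _ fun σ ↦ rfl
  have hadj (ρ : G) : (M ρ).det • ((M ρ).transpose * S) = |(M ρ).det| • (S * (M ρ).adjugate) := by
    have := congrArg (· * (M ρ).adjugate) (hinv ρ)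
    simpa [Matrix.mul_assoc, Matrix.mul_adjugate] using this
  refine ⟨S 0 0, S 0 1, S 1 1, hA, ?_, fun ρ ↦ ⟨fun hρ ↦ ?_, fun hρ ↦ ?_⟩⟩
  · have := hpos (-S 0 1) (S 0 0) (by simp [hA.ne'])
    nlinarith
  · have h0 := hadj ρ
    rw [abs_of_pos hρ] at h0
    have h1 := smul_right_injective _ hρ.ne' h0
    have h00 := congrFun₂ h1 0 0
    have h01 := congrFun₂ h1 0 1
    simp [Matrix.mul_apply, Matrix.adjugate_fin_two, hsymm] at h00 h01
    exact ⟨by linear_combination h00, by linear_combination h01⟩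
  · have h0 := hadj ρ
    rw [abs_of_neg hρ, ← sub_eq_zero, neg_smul, sub_neg_eq_add, ← smul_add] at h0
    have h1 := (smul_eq_zero.1 h0).resolve_left hρ.ne
    have h00 := congrFun₂ h1 0 0
    simp [Matrix.mul_apply, Matrix.adjugate_fin_two, hsymm] at h00
    apply mul_left_cancel₀ hA.ne'
    linear_combination h00

theorem exists_sign (h : IsTwistedRepresentation n M e) :
    ∃ ε : G →* ℤˣ, ∀ σ, (ε σ = 1 ↔ 0 < (M σ).det) ∧ (ε σ = -1 ↔ (M σ).det < 0) := by
  have hmul (σ τ : G) : 0 < (M (σ * τ)).det ↔ (0 < (M σ).det ↔ 0 < (M τ).det) := by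
    obtain ⟨l, hl, -, -, hd⟩ := h.exists_det_mul σ τ
    have hl2 : 0 < l ^ 2 := by positivity
    rw [← mul_pos_iff_of_pos_left hl2, ← hd, mul_pos_iff]
    have h1 := (h.det_ne_zero σ).lt_or_gt
    have h2 := (h.det_ne_zero τ).lt_or_gt
    rcases h1 with h1 | h1 <;> rcases h2 with h2 | h2 <;>
      simp [h1, h2, h1.not_gt, h2.not_gt]
  refine ⟨.mk' (fun σ ↦ if 0 < (M σ).det then 1 else -1) fun σ τ ↦ ?_, fun σ ↦ ?_⟩
  · by_cases h1 : 0 < (M σ).det <;> by_cases h2 : 0 < (M τ).det <;> simp [hmul, h1, h2]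
  · have := h.det_ne_zero σ
    by_cases h1 : 0 < (M σ).det
    · simp [h1, h1.le]
    · simp [h1, lt_of_le_of_ne (not_lt.1 h1) this]

theorem mul_self_eq_one (h : IsTwistedRepresentation n M e) [Finite G] {σ : G}
    (hd : (M σ).det < 0) (ht : M σ 0 0 + M σ 1 1 = 0) : σ * σ = 1 := by
  obtain ⟨l, hl, hm, he⟩ := h.exists_mul σ σ
  have hsq : M σ * M σ = (-(M σ).det) • 1 := by
    ext i j
    fin_cases i <;> fin_cases j <;> simp [Matrix.mul_apply, Matrix.det_fin_two]
    · linear_combination M σ 0 0 * ht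
    · linear_combination M σ 0 1 * ht
    · linear_combination M σ 1 0 * ht
    · linear_combination M σ 1 1 * ht
  refine h.eq_one (l := -(M σ).det / l) ?_ ?_
  · have := congrArg (l⁻¹ • ·) (hsq.symm.trans hm)
    rw [div_eq_inv_mul, ← smul_smul]
    simpa [smul_smul, hl] using this.symm
  · rw [div_pow, eq_div_iff (pow_ne_zero n hl), ← abs_of_neg hd, ← h.e_sq σ]
    linear_combination -he

end IsTwistedRepresentation

theorem Complex.exists_quadratic_root {A B C : ℚ} (hA : 0 < A) (hB : B ^ 2 < A * C) :
    ∃ t : ℂ, A * t ^ 2 + 2 * B * t + C = 0 ∧ t.im ≠ 0 := by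
  have hd : (0 : ℝ) < A * C - B ^ 2 := by exact_mod_cast sub_pos.2 hB
  have hA' : (A : ℂ) ≠ 0 := by exact_mod_cast hA.ne'
  have hs : ((√(A * C - B ^ 2) : ℝ) : ℂ) ^ 2 = A * C - B ^ 2 := by
    rw [← Complex.ofReal_pow, Real.sq_sqrt hd.le]
    push_cast
    rfl
  refine ⟨-B / A + (√(A * C - B ^ 2) / A : ℝ) * I, ?_, ?_⟩
  · push_cast
    field_simp
    linear_combination hs * I ^ 2 + (A * C - B ^ 2) * I_sq
  · have : (-(B : ℂ) / A).im = 0 := by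
      rw [show (-(B : ℂ) / A) = ((-B / A : ℚ) : ℂ) by push_cast; rfl, Complex.ratCast_im]
    rw [Complex.add_im, this, Complex.im_ofReal_mul]
    simp [(Real.sqrt_pos.2 hd).ne', hA.ne']

namespace IsTwistedRepresentation

variable {G : Type*} [Group G] {n : ℕ} {M : G → Matrix (Fin 2) (Fin 2) ℚ} {e : G → ℚ}

/-- The automorphy factor at a fixed point in the upper half plane of the elements of positive
determinant. -/
theorem exists_automorphy_factor (h : IsTwistedRepresentation n M e) [Finite G] :
    ∃ z : G → ℂ, (∀ σ, 0 < (M σ).det → z σ + starRingEnd ℂ (z σ) = (M σ).trace ∧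
        z σ * starRingEnd ℂ (z σ) = (M σ).det ∧
        (starRingEnd ℂ (z σ) = z σ → ∃ d : ℚ, M σ = d • 1 ∧ z σ = d)) ∧
      (∀ σ τ, 0 < (M σ).det → 0 < (M τ).det → ∀ l : ℚ, M τ * M σ = l • M (σ * τ) →
        z τ * z σ = l * z (σ * τ)) ∧
      ∀ σ, (M σ).det < 0 → σ * σ = 1 := by
  obtain ⟨A, B, C, hA, hB, hS⟩ := h.exists_form
  obtain ⟨t, ht, him⟩ := Complex.exists_quadratic_root hA hB
  have hA' : (A : ℂ) ≠ 0 := by exact_mod_cast hA.ne'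
  have htc : A * (starRingEnd ℂ t) ^ 2 + 2 * B * starRingEnd ℂ t + C = 0 := by
    simpa [Complex.conj_ofNat] using congrArg (starRingEnd ℂ) ht
  have hne : t - starRingEnd ℂ t ≠ 0 := by
    rw [sub_ne_zero]
    exact fun h ↦ him (Complex.conj_eq_iff_im.1 h.symm)
  have hsum : A * (t + starRingEnd ℂ t) = -2 * B := by
    apply mul_left_cancel₀ hne
    linear_combination ht - htc
  have hprod : A * (t * starRingEnd ℂ t) = C := by
    linear_combination t * hsum - ht
  have hS₁ (σ : G) (hσ : 0 < (M σ).det) :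
      (A : ℂ) * (M σ 0 0 - M σ 1 1) = -2 * (B * M σ 1 0) ∧ (A : ℂ) * M σ 0 1 = -(C * M σ 1 0) := by
    exact_mod_cast (hS σ).1 hσ
  refine ⟨fun σ ↦ M σ 1 0 * t + M σ 1 1, fun σ hσ ↦ ⟨?_, ?_, fun hc ↦ ?_⟩, fun σ τ hσ hτ l hl ↦ ?_,
    fun σ hσ ↦ h.mul_self_eq_one hσ ((hS σ).2 hσ)⟩
  · apply mul_left_cancel₀ hA'
    simp only [map_add, map_mul, map_ratCast, Matrix.trace_fin_two, Rat.cast_add]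
    linear_combination M σ 1 0 * hsum - (hS₁ σ hσ).1
  · apply mul_left_cancel₀ hA'
    simp only [map_add, map_mul, map_ratCast, Matrix.det_fin_two, Rat.cast_sub, Rat.cast_mul]
    linear_combination (M σ 1 0 : ℂ) ^ 2 * hprod + M σ 1 0 * M σ 1 1 * hsum -
      M σ 1 1 * (hS₁ σ hσ).1 + M σ 1 0 * (hS₁ σ hσ).2
  · simp only [map_add, map_mul, map_ratCast] at hc
    have hc0 : M σ 1 0 = 0 := by
      have : (M σ 1 0 : ℂ) * (t - starRingEnd ℂ t) = 0 := by linear_combination -hc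
      exact_mod_cast (mul_eq_zero.1 this).resolve_right hne
    obtain ⟨h1, h2⟩ := (hS σ).1 hσ
    rw [hc0, mul_zero, mul_zero, mul_eq_zero, or_iff_right hA.ne', sub_eq_zero] at h1
    rw [hc0, mul_zero, neg_zero, mul_eq_zero, or_iff_right hA.ne'] at h2
    refine ⟨M σ 1 1, ?_, by simp [hc0]⟩
    ext i j
    fin_cases i <;> fin_cases j <;> simp [hc0, h1, h2]
  · have e0 := congrFun₂ hl 1 0
    have e1 := congrFun₂ hl 1 1
    simp only [Matrix.mul_apply, Fin.sum_univ_two, Matrix.smul_apply, smul_eq_mul] at e0 e1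
    have e0' : (M τ 1 0 : ℂ) * M σ 0 0 + M τ 1 1 * M σ 1 0 = l * M (σ * τ) 1 0 := by
      exact_mod_cast e0
    have e1' : (M τ 1 0 : ℂ) * M σ 0 1 + M τ 1 1 * M σ 1 1 = l * M (σ * τ) 1 1 := by
      exact_mod_cast e1
    apply mul_left_cancel₀ hA'
    linear_combination A * t * e0' + A * e1' + M τ 1 0 * M σ 1 0 * ht -
      M τ 1 0 * t * (hS₁ σ hσ).1 - M τ 1 0 * (hS₁ σ hσ).2

theorem exists_dihedralGroup_of_even (h : IsTwistedRepresentation n M e) [Finite G] {m : ℕ}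
    (hn : n + 1 = 2 * m) :
    (∃ f : G →* DihedralGroup 4, Function.Injective f) ∨
      ∃ f : G →* DihedralGroup 6, Function.Injective f := by
  obtain ⟨ε, hε⟩ := h.exists_sign
  obtain ⟨z, hz, hzmul, hz2⟩ := h.exists_automorphy_factor
  have hdet (σ : G) : ((M σ).det : ℂ) ≠ 0 := by exact_mod_cast h.det_ne_zero σ
  have hχ (σ τ : G) (hσ : ε σ = 1) (hτ : ε τ = 1) :
      (e (σ * τ) * z (σ * τ) / (M (σ * τ)).det ^ m : ℂ) =
        e σ * z σ / (M σ).det ^ m * (e τ * z τ / (M τ).det ^ m) := by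
    obtain ⟨l, hl, hm, he, hd⟩ := h.exists_det_mul σ τ
    have h1 := hzmul σ τ ((hε σ).1.1 hσ) ((hε τ).1.1 hτ) l hm
    have he' : (e τ * e σ : ℂ) = l ^ n * e (σ * τ) := by exact_mod_cast he
    have hd' : ((M τ).det * (M σ).det : ℂ) = l ^ 2 * (M (σ * τ)).det := by exact_mod_cast hd
    have hl' : (l : ℂ) ≠ 0 := by exact_mod_cast hl
    have h2 : e σ * z σ / (M σ).det ^ m * (e τ * z τ / (M τ).det ^ m) =
        (e τ * e σ) * (z τ * z σ) / ((M τ).det * (M σ).det : ℂ) ^ m := by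
      rw [mul_pow, div_mul_div_comm]
      ring
    have h3 : (l : ℂ) ^ n * l = (l ^ 2) ^ m := by rw [← pow_succ, hn, pow_mul]
    rw [h2, h1, he', hd', mul_pow, ← h3, mul_mul_mul_comm,
      mul_div_mul_left _ _ (mul_ne_zero (pow_ne_zero n hl') hl')]
  refine DihedralGroup.exists_injective_four_or_six ε (fun σ ↦ e σ * z σ / (M σ).det ^ m) hχ ?_
    (fun σ hσ h1 ↦ ?_) (fun σ hσ ↦ ⟨e σ * (M σ).trace / (M σ).det ^ m, ?_⟩)
    fun σ hσ ↦ hz2 σ ((hε σ).2.1 hσ)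
  · have h1 := hχ 1 1 (map_one ε) (map_one ε)
    rw [mul_one] at h1
    have hz0 : z 1 ≠ 0 := by
      intro h0
      have := (hz 1 ((hε 1).1.1 (map_one ε))).2.1
      rw [h0, zero_mul] at this
      exact hdet 1 this.symm
    exact (mul_eq_left₀ (div_ne_zero (mul_ne_zero (by exact_mod_cast h.e_ne_zero 1) hz0)
      (pow_ne_zero m (hdet 1)))).1 h1.symm
  · have he0 : (e σ : ℂ) ≠ 0 := by exact_mod_cast h.e_ne_zero σ
    have h1' : (e σ * z σ : ℂ) = (M σ).det ^ m := by
      rwa [div_eq_one_iff_eq (pow_ne_zero m (hdet σ))] at h1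
    obtain ⟨d, hd, hzd⟩ := (hz σ ((hε σ).1.1 hσ)).2.2 (by
      apply mul_left_cancel₀ he0
      have := congrArg (starRingEnd ℂ) h1'
      simp only [map_mul, map_pow, map_ratCast] at this
      rw [this, h1'])
    have hdd : (M σ).det = d ^ 2 := by simp [hd]
    refine h.eq_one hd ?_
    have hd0 : d ≠ 0 := by
      rintro rfl
      exact h.det_ne_zero σ (by simpa using hdd)
    apply mul_right_cancel₀ hd0
    rw [← pow_succ, hn, pow_mul, ← hdd]
    rw [hzd] at h1'
    exact_mod_cast h1'
  · simp only [map_mul, map_div₀, map_pow, map_ratCast]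
    push_cast
    rw [← (hz σ ((hε σ).1.1 hσ)).1]
    ring

theorem exists_dihedralGroup_of_eq (h : IsTwistedRepresentation n M e) [Finite G] {m : ℕ}
    (hn : n = 2 * m) (he : ∀ σ, e σ = (M σ).det ^ m) :
    (∃ f : G →* DihedralGroup 4, Function.Injective f) ∨
      ∃ f : G →* DihedralGroup 6, Function.Injective f := by
  obtain ⟨ε, hε⟩ := h.exists_sign
  obtain ⟨z, hz, hzmul, hz2⟩ := h.exists_automorphy_factor
  have hz0 {σ : G} (hσ : ε σ = 1) : z σ ≠ 0 ∧ starRingEnd ℂ (z σ) ≠ 0 := by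
    have := (hz σ ((hε σ).1.1 hσ)).2.1
    rw [← mul_ne_zero_iff, this]
    exact_mod_cast h.det_ne_zero σ
  have hχ (σ τ : G) (hσ : ε σ = 1) (hτ : ε τ = 1) :
      z (σ * τ) / starRingEnd ℂ (z (σ * τ)) =
        z σ / starRingEnd ℂ (z σ) * (z τ / starRingEnd ℂ (z τ)) := by
    obtain ⟨l, hl, hm, -⟩ := h.exists_mul σ τ
    have h1 := hzmul σ τ ((hε σ).1.1 hσ) ((hε τ).1.1 hτ) l hm
    have h2 := congrArg (starRingEnd ℂ) h1
    simp only [map_mul, map_ratCast] at h2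
    have hl' : (l : ℂ) ≠ 0 := by exact_mod_cast hl
    rw [div_mul_div_comm, mul_comm (z σ), mul_comm (starRingEnd ℂ (z σ)), h1, h2,
      mul_div_mul_left _ _ hl']
  refine DihedralGroup.exists_injective_four_or_six ε (fun σ ↦ z σ / starRingEnd ℂ (z σ)) hχ ?_
    (fun σ hσ h1 ↦ ?_) (fun σ hσ ↦ ⟨((M σ).trace ^ 2 - 2 * (M σ).det) / (M σ).det, ?_⟩)
    fun σ hσ ↦ hz2 σ ((hε σ).2.1 hσ)
  · have h1 := hχ 1 1 (map_one ε) (map_one ε)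
    rw [mul_one] at h1
    obtain ⟨h2, h3⟩ := hz0 (map_one ε)
    exact (mul_eq_left₀ (div_ne_zero h2 h3)).1 h1.symm
  · obtain ⟨d, hd, -⟩ := (hz σ ((hε σ).1.1 hσ)).2.2 ((div_eq_one_iff_eq (hz0 hσ).2).1 h1).symm
    refine h.eq_one hd ?_
    rw [he, hn, hd, pow_mul]
    simp
  · obtain ⟨h1, h2, -⟩ := hz σ ((hε σ).1.1 hσ)
    obtain ⟨h3, h4⟩ := hz0 hσ
    simp only [map_div₀, Complex.conj_conj]
    rw [Rat.cast_div, Rat.cast_sub, Rat.cast_mul, Rat.cast_pow, Rat.cast_ofNat, ← h1, ← h2]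
    field_simp
    ring

end IsTwistedRepresentation

theorem IsHyperellipticFunctionField.isTwistedRepresentation {F : ℚ[X]} {K : Type*} [Field K]
    [Algebra ℚ K] {x y : K} (h : IsHyperellipticFunctionField ℚ F K x y) (hF : F ≠ 0) {g : ℕ}
    {M : (K ≃ₐ[ℚ] K) → GL (Fin 2) ℚ} {e : (K ≃ₐ[ℚ] K) → ℚˣ}
    (hMe : ∀ σ, Represents g x y x y σ (M σ) (e σ)) :
    IsTwistedRepresentation (g + 1) (fun σ ↦ (M σ).val) fun σ ↦ (e σ : ℚ) where
  det_ne_zero σ := (M σ).det_ne_zero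
  exists_mul σ τ := by
    obtain ⟨l, hl₁, hl₂⟩ :=
      h.eq_smul_of_represents hF (hMe (σ * τ)) (h.represents_mul (hMe σ) (hMe τ))
    refine ⟨l, ?_, by simpa using hl₁, by simpa using hl₂⟩
    rintro rfl
    simp at hl₂
  eq_of_smul {σ τ l} hM he := (h.eq_of_represents (hMe τ) (hMe σ) hM he).symm
  e_ne_zero σ := (e σ).ne_zero

theorem IsTwistedRepresentation.exists_character {G : Type*} [Group G] [Finite G] {n m : ℕ}
    {M : G → Matrix (Fin 2) (Fin 2) ℚ} {e : G → ℚ} (h : IsTwistedRepresentation n M e)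
    (hn : n = 2 * m) {w : G} {l : ℚ} (hw : M w = l • 1) (hw' : e w = -l ^ n) :
    ∃ χ : G →* ℚ, (∀ σ, χ σ = 1 → e σ = (M σ).det ^ m) ∧ (∀ σ, χ σ = 1 ∨ χ σ = -1) ∧
      χ w = -1 := by
  have h0 (σ : G) := pow_ne_zero m (h.det_ne_zero σ)
  have hmul (σ τ : G) : e (σ * τ) / (M (σ * τ)).det ^ m =
      e σ / (M σ).det ^ m * (e τ / (M τ).det ^ m) := by
    obtain ⟨l, hl, -, he, hd⟩ := h.exists_det_mul σ τ
    have hd' := congrArg (· ^ m) hd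
    simp only [mul_pow] at hd'
    rw [div_mul_div_comm, div_eq_div_iff (h0 _) (mul_ne_zero (h0 _) (h0 _))]
    rw [hn] at he
    linear_combination e (σ * τ) * hd' - (M (σ * τ)).det ^ m * he
  have h1 : e 1 / (M 1).det ^ m = 1 := by
    have := hmul 1 1
    rw [mul_one] at this
    exact (mul_eq_left₀ (div_ne_zero (h.e_ne_zero 1) (h0 1))).1 this.symm
  refine ⟨⟨⟨fun σ ↦ e σ / (M σ).det ^ m, h1⟩, hmul⟩, fun σ hσ ↦ (div_eq_one_iff_eq (h0 σ)).1 hσ,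
    fun σ ↦ ?_, ?_⟩
  · rw [← sq_eq_one_iff]
    change (e σ / (M σ).det ^ m) ^ 2 = 1
    rw [div_pow, h.e_sq, hn, Even.pow_abs (even_two_mul m), ← pow_mul, mul_comm m,
      div_self (pow_ne_zero _ (h.det_ne_zero σ))]
  · change e w / (M w).det ^ m = -1
    have hd : (M w).det ^ m = l ^ n := by simp [hw, hn, pow_mul]
    rw [div_eq_iff (h0 w), hd, hw']
    ring

theorem Subgroup.isInternalProduct_of_character {G : Type*} [Group G] {w : G} (χ : G →* ℚ)
    (hχ : ∀ σ, χ σ = 1 ∨ χ σ = -1) (hw : χ w = -1) (hw2 : w * w = 1) :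
    orderOf w = 2 ∧ Subgroup.zpowers w ⊓ χ.ker = ⊥ ∧ Subgroup.zpowers w ⊔ χ.ker = ⊤ := by
  have hw1 : w ≠ 1 := by
    rintro rfl
    norm_num at hw
  refine ⟨orderOf_eq_prime (by rw [sq, hw2]) hw1, ?_, ?_⟩
  · rw [eq_bot_iff]
    rintro _ ⟨⟨k, rfl⟩, hk⟩
    rcases Int.even_or_odd' k with ⟨j, rfl | rfl⟩
    · simp [zpow_mul, zpow_ofNat, sq, hw2]
    · exfalso
      have : χ (w ^ (2 * j + 1)) = 1 := hk
      rw [zpow_add, zpow_mul, zpow_ofNat, sq, hw2, one_zpow, one_mul, zpow_one, hw] at this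
      norm_num at this
  · rw [eq_top_iff]
    rintro σ -
    rcases hχ σ with hσ | hσ
    · exact Subgroup.mem_sup_right hσ
    · rw [← one_mul σ, ← hw2, mul_assoc]
      exact Subgroup.mul_mem_sup (Subgroup.mem_zpowers w)
        (show χ (w * σ) = 1 by rw [map_mul, hw, hσ]; norm_num)

theorem DihedralGroup.exists_subgroup_mulEquiv {Γ : Type*} [Group Γ] {n : ℕ}
    {f : Γ →* DihedralGroup n} (hf : Function.Injective f) :
    ∃ D : Subgroup (DihedralGroup n), Nonempty (Γ ≃* D) :=
  ⟨f.range, ⟨f.ofInjective hf⟩⟩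

theorem DihedralGroup.pow_four_or_six_eq_one {Γ : Type*} [Group Γ]
    (h : (∃ f : Γ →* DihedralGroup 4, Function.Injective f) ∨
      ∃ f : Γ →* DihedralGroup 6, Function.Injective f) (u : Γ) : u ^ 4 = 1 ∨ u ^ 6 = 1 := by
  refine h.imp ?_ ?_ <;>
  · rintro ⟨f, hf⟩
    apply hf
    rw [map_pow, map_one]
    have := Monoid.pow_exponent_eq_one (f u)
    rw [DihedralGroup.exponent] at this
    exact this

theorem orderOf_mem_of_pow_four_or_six_eq_one {Γ : Type*} [Monoid Γ] {u : Γ}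
    (h : u ^ 4 = 1 ∨ u ^ 6 = 1) : orderOf u ∈ ({1, 2, 3, 4, 6} : Set ℕ) := by
  have h' : orderOf u ∈ Nat.divisors 4 ∨ orderOf u ∈ Nat.divisors 6 := by
    simpa [orderOf_dvd_iff_pow_eq_one] using h
  rw [show Nat.divisors 4 = {1, 2, 4} by decide, show Nat.divisors 6 = {1, 2, 3, 6} by decide] at h'
  simp only [Finset.mem_insert, Finset.mem_singleton, Set.mem_insert_iff,
    Set.mem_singleton_iff] at h' ⊢
  omega

/-- For the hyperelliptic function field `K = ℚ(x)(y)`, `y² = F(x)`, of genus `g ≥ 2`,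
with automorphism group `G = Aut_ℚ(K)` and hyperelliptic involution `w`:
if `g` is even, `G` is isomorphic to a subgroup of `D₈` or `D₁₂`; if `g` is odd, `G`
is the internal direct product of `⟨w⟩` (of order 2) and a subgroup `H` isomorphic to
a subgroup of `D₈` or `D₁₂`; in either case every element of `G` has order
`1, 2, 3, 4`, or `6`. -/
theorem stmt_8 (g : ℕ) (hg : 2 ≤ g)
    (F : ℚ[X]) (hF : Squarefree F)
    (hdF : F.natDegree = 2 * g + 1 ∨ F.natDegree = 2 * g + 2)
    {K : Type*} [Field K] [Algebra ℚ K] (x y : K)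
    (hK : IsHyperellipticFunctionField ℚ F K x y)
    (w : K ≃ₐ[ℚ] K) (hwx : w x = x) (hwy : w y = -y) :
    (Even g →
      (∃ D : Subgroup (DihedralGroup 4), Nonempty ((K ≃ₐ[ℚ] K) ≃* D)) ∨
      (∃ D : Subgroup (DihedralGroup 6), Nonempty ((K ≃ₐ[ℚ] K) ≃* D))) ∧
    (Odd g →
      ∃ H : Subgroup (K ≃ₐ[ℚ] K),
        ((∃ D : Subgroup (DihedralGroup 4), Nonempty (H ≃* D)) ∨
         (∃ D : Subgroup (DihedralGroup 6), Nonempty (H ≃* D))) ∧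
        orderOf w = 2 ∧
        Subgroup.zpowers w ⊓ H = ⊥ ∧
        Subgroup.zpowers w ⊔ H = ⊤ ∧
        (∀ h ∈ H, Commute w h)) ∧
    (∀ u : K ≃ₐ[ℚ] K, orderOf u ∈ ({1, 2, 3, 4, 6} : Set ℕ)) := by
  have hl : 2 * g + 1 ≤ F.natDegree := by omega
  have hu : F.natDegree ≤ 2 * g + 2 := by omega
  choose M e hMe using hK.exists_represents hg hF hl hu (w := w.toAlgHom) hwx hwy
  have h := hK.isTwistedRepresentation hF.ne_zero hMe
  have hfin := hK.finite_algEquiv hg hF hl hu hwx hwy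
  have hw2 : w * w = 1 := hK.algEquiv_ext (by simp [hwx]) (by simp [hwy])
  have hcomm (σ : K ≃ₐ[ℚ] K) : Commute w σ := by
    refine hK.algEquiv_ext ?_ ?_
    · simp [hwx, (hMe σ).1]
    · simp [hwx, hwy, (hMe σ).2, mul_neg, neg_div]
  have himp {Γ : Type _} [Group Γ] (hΓ : (∃ f : Γ →* DihedralGroup 4, Function.Injective f) ∨
      ∃ f : Γ →* DihedralGroup 6, Function.Injective f) :
      (∃ D : Subgroup (DihedralGroup 4), Nonempty (Γ ≃* D)) ∨
        ∃ D : Subgroup (DihedralGroup 6), Nonempty (Γ ≃* D) :=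
    hΓ.imp (fun ⟨_, hf⟩ ↦ DihedralGroup.exists_subgroup_mulEquiv hf)
      fun ⟨_, hf⟩ ↦ DihedralGroup.exists_subgroup_mulEquiv hf
  have heven (hg : Even g) : (∃ f : (K ≃ₐ[ℚ] K) →* DihedralGroup 4, Function.Injective f) ∨
      ∃ f : (K ≃ₐ[ℚ] K) →* DihedralGroup 6, Function.Injective f := by
    obtain ⟨r, rfl⟩ := hg
    exact h.exists_dihedralGroup_of_even (m := r + 1) (by omega)
  have hodd (hg : Odd g) : ∃ χ : (K ≃ₐ[ℚ] K) →* ℚ, (∀ σ, χ σ = 1 ∨ χ σ = -1) ∧ χ w = -1 ∧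
      ((∃ f : χ.ker →* DihedralGroup 4, Function.Injective f) ∨
        ∃ f : χ.ker →* DihedralGroup 6, Function.Injective f) := by
    obtain ⟨r, rfl⟩ := hg
    obtain ⟨l, hl₁, hl₂⟩ :=
      hK.eq_smul_of_represents hF.ne_zero
        (IsHyperellipticFunctionField.represents_involution hwx hwy) (hMe w)
    obtain ⟨χ, hχ, hχ₁, hχw⟩ := h.exists_character (m := r + 1) (by omega) (w := w) (l := l)
      (by simpa using hl₁) (by simpa using hl₂)
    exact ⟨χ, hχ₁, hχw, (h.subgroup χ.ker).exists_dihedralGroup_of_eq (m := r + 1) (by omega)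
      fun σ ↦ hχ σ σ.2⟩
  refine ⟨fun hg ↦ himp (heven hg), fun hg ↦ ?_, fun u ↦ orderOf_mem_of_pow_four_or_six_eq_one ?_⟩
  · obtain ⟨χ, hχ, hχw, hχ'⟩ := hodd hg
    obtain ⟨h₁, h₂, h₃⟩ := Subgroup.isInternalProduct_of_character χ hχ hχw hw2
    exact ⟨χ.ker, himp hχ', h₁, h₂, h₃, fun σ _ ↦ hcomm σ⟩
  · rcases Nat.even_or_odd g with hg | hg
    · exact DihedralGroup.pow_four_or_six_eq_one (heven hg) u
    · obtain ⟨χ, hχ, hχw, hχ'⟩ := hodd hg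
      have hker (σ : χ.ker) : (σ : K ≃ₐ[ℚ] K) ^ 4 = 1 ∨ (σ : K ≃ₐ[ℚ] K) ^ 6 = 1 :=
        (DihedralGroup.pow_four_or_six_eq_one hχ' σ).imp (congrArg Subtype.val)
          (congrArg Subtype.val)
      rcases hχ u with hu | hu
      · exact hker ⟨u, hu⟩
      · have hw4 : w ^ 4 = 1 := by rw [pow_mul w 2 2, sq w, hw2, one_pow]
        have hw6 : w ^ 6 = 1 := by rw [pow_mul w 2 3, sq w, hw2, one_pow]
        have := hker ⟨w * u, show χ (w * u) = 1 by rw [map_mul, hχw, hu]; norm_num⟩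
        simpa only [(hcomm u).mul_pow, hw4, hw6, one_mul] using this
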